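/- Let 𝒮 := R_n* + R_n be the operator system given by the norm closure in B(F²(Hₙ)) of the linear span of {R_α : α ∈ 𝔽ₙ⁺} ∪ {R_α* : α ∈ 𝔽ₙ⁺}, and call a linear functional μ : 𝒮 → ℂ positive if μ(T) is a nonnegative real number whenever T ∈ 𝒮 is a positive operator. For a positive linear functional μ on 𝒮, define coefficients a^μ_{g₀} := μ(I), a^μ_α := μ(R_{α̃}*) for |α| ≥ 1, and b^μ_α := μ(R_{α̃}) for |α| ≥ 1 (α̃ the reverse of α). Then: (1) for every positive linear functional μ on 𝒮 the pair (a^μ, b^μ) satisfies the radius-1 limsup conditions and its associated free pluriharmonic function u^μ is positive on the unit ball; (2) the map μ ↦ (a^μ, b^μ) is injective; and (3) every coefficient pair (a, b) satisfying the radius-1 limsup conditions whose associated free pluriharmonic function is positive on the unit ball equals (a^μ, b^μ) for some positive linear functional μ on 𝒮. In other words, μ ↦ u^μ is a one-to-one correspondence between positive linear functionals on R_n* + R_n and positive free pluriharmonic functions with scalar coefficients on the unit ball. -/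

import Mathlib

open scoped ENNReal ComplexOrder
open Filter ContinuousLinearMap

noncomputable section

abbrev Word (n : ℕ) := FreeMonoid (Fin n)

/-- The word determined by a tuple of letters. -/
def word {n k : ℕ} (f : Fin k → Fin n) : Word n :=
  FreeMonoid.ofList (List.ofFn f)

/-- The length of a word. -/
def wordLen {n : ℕ} (α : Word n) : ℕ := (FreeMonoid.toList α).length

/-- The product `X_α = X_{i₁} ⋯ X_{i_k}` for `α = g_{i₁} ⋯ g_{i_k}`. -/
def wordProd {n : ℕ} {K : Type} [NormedAddCommGroup K] [InnerProductSpace ℂ K]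
    (X : Fin n → K →L[ℂ] K) (α : Word n) : K →L[ℂ] K :=
  ((FreeMonoid.toList α).map X).prod

/-- `Σ_{|α| = k} a_α X_α`. -/
def truncSum {n : ℕ} {K : Type} [NormedAddCommGroup K] [InnerProductSpace ℂ K]
    (a : Word n → ℂ) (X : Fin n → K →L[ℂ] K) (k : ℕ) : K →L[ℂ] K :=
  ∑ f : Fin k → Fin n, a (word f) • wordProd X (word f)

/-- `Σ_{|α| = k} b_α X_α*`. -/
def truncSumAdj {n : ℕ} {K : Type} [NormedAddCommGroup K] [InnerProductSpace ℂ K]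
    [CompleteSpace K] (b : Word n → ℂ) (X : Fin n → K →L[ℂ] K) (k : ℕ) : K →L[ℂ] K :=
  ∑ f : Fin k → Fin n, b (word f) • adjoint (wordProd X (word f))

/-- The free holomorphic function `f(X) = Σ_k Σ_{|α| = k} a_α X_α`. -/
def holOp {n : ℕ} {K : Type} [NormedAddCommGroup K] [InnerProductSpace ℂ K]
    (a : Word n → ℂ) (X : Fin n → K →L[ℂ] K) : K →L[ℂ] K :=
  ∑' k : ℕ, truncSum a X k

/-- The free pluriharmonic function
`u(X) = Σ_{k ≥ 1} Σ_{|α| = k} b_α X_α* + a_{g₀} I + Σ_{k ≥ 1} Σ_{|α| = k} a_α X_α`. -/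
def phOp {n : ℕ} {K : Type} [NormedAddCommGroup K] [InnerProductSpace ℂ K]
    [CompleteSpace K] (a b : Word n → ℂ) (X : Fin n → K →L[ℂ] K) : K →L[ℂ] K :=
  (∑' k : ℕ, truncSumAdj b X (k + 1)) + a 1 • (1 : K →L[ℂ] K)
    + ∑' k : ℕ, truncSum a X (k + 1)

/-- Membership in the open noncommutative ball of radius `γ`. -/
def inBall {n : ℕ} {K : Type} [NormedAddCommGroup K] [InnerProductSpace ℂ K]
    [CompleteSpace K] (γ : ℝ) (X : Fin n → K →L[ℂ] K) : Prop :=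
  ‖∑ i, X i * adjoint (X i)‖ < γ ^ 2

/-- Membership in the closed noncommutative ball of radius `γ`. -/
def inClosedBall {n : ℕ} {K : Type} [NormedAddCommGroup K] [InnerProductSpace ℂ K]
    [CompleteSpace K] (γ : ℝ) (X : Fin n → K →L[ℂ] K) : Prop :=
  ‖∑ i, X i * adjoint (X i)‖ ≤ γ ^ 2

/-- The radius-`γ` condition `limsup_k (Σ_{|α|=k} |a_α|²)^{1/(2k)} ≤ 1/γ`. -/
def radCond {n : ℕ} (γ : ℝ) (a : Word n → ℂ) : Prop :=
  Filter.limsup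
    (fun k : ℕ =>
      (∑ f : Fin k → Fin n, (‖a (word f)‖₊ : ℝ≥0∞) ^ 2) ^ ((1 : ℝ) / (2 * (k : ℝ))))
    Filter.atTop ≤ ENNReal.ofReal (1 / γ)

/-- The coefficients of the radial function: `α ↦ r^{|α|} a_α`. -/
def scaleCoef {n : ℕ} (r : ℝ) (a : Word n → ℂ) : Word n → ℂ :=
  fun α => ((r : ℂ) ^ wordLen α) * a α

/-- Positivity of the free pluriharmonic function with coefficients `(a, b)` on the
noncommutative ball of radius `γ` of every complex Hilbert space. -/
def posPH {n : ℕ} (γ : ℝ) (a b : Word n → ℂ) : Prop :=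
  ∀ (K : Type) [NormedAddCommGroup K] [InnerProductSpace ℂ K] [CompleteSpace K],
    ∀ X : Fin n → K →L[ℂ] K, inBall γ X → (phOp a b X).IsPositive


/-- The operator system `R_n* + R_n`: the norm closure of the linear span of
`{R_α} ∪ {R_α*}`. -/
def opSys {n : ℕ} {F : Type} [NormedAddCommGroup F] [InnerProductSpace ℂ F]
    [CompleteSpace F] (R : Fin n → F →L[ℂ] F) : Submodule ℂ (F →L[ℂ] F) :=
  (Submodule.span ℂ
    ((Set.range fun α : Word n => wordProd R α) ∪
      (Set.range fun α : Word n => adjoint (wordProd R α)))).topologicalClosure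

/-- `R_α` as an element of the operator system `R_n* + R_n`. -/
def elR {n : ℕ} {F : Type} [NormedAddCommGroup F] [InnerProductSpace ℂ F]
    [CompleteSpace F] (R : Fin n → F →L[ℂ] F) (α : Word n) : ↥(opSys R) :=
  ⟨wordProd R α,
    Submodule.le_topologicalClosure _ (Submodule.subset_span (Or.inl ⟨α, rfl⟩))⟩

/-- `R_α*` as an element of the operator system `R_n* + R_n`. -/
def elRadj {n : ℕ} {F : Type} [NormedAddCommGroup F] [InnerProductSpace ℂ F]
    [CompleteSpace F] (R : Fin n → F →L[ℂ] F) (α : Word n) : ↥(opSys R) :=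
  ⟨adjoint (wordProd R α),
    Submodule.le_topologicalClosure _ (Submodule.subset_span (Or.inr ⟨α, rfl⟩))⟩

/-- Positivity of a linear functional on the operator system `R_n* + R_n`. -/
def posFun {n : ℕ} {F : Type} [NormedAddCommGroup F] [InnerProductSpace ℂ F]
    [CompleteSpace F] (R : Fin n → F →L[ℂ] F) (μ : ↥(opSys R) →ₗ[ℂ] ℂ) : Prop :=
  ∀ T : ↥(opSys R), (T : F →L[ℂ] F).IsPositive → 0 ≤ μ T

/-- The reverse of a word. -/
def revWord {n : ℕ} (α : Word n) : Word n :=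
  FreeMonoid.ofList (FreeMonoid.toList α).reverse

/-- The coefficients `a^μ_α := μ(R_{α̃}*)` (so `a^μ_{g₀} = μ(I)`). -/
def aCoeff {n : ℕ} {F : Type} [NormedAddCommGroup F] [InnerProductSpace ℂ F]
    [CompleteSpace F] (R : Fin n → F →L[ℂ] F) (μ : ↥(opSys R) →ₗ[ℂ] ℂ) :
    Word n → ℂ :=
  fun α => μ (elRadj R (revWord α))

/-- The coefficients `b^μ_α := μ(R_{α̃})`. -/
def bCoeff {n : ℕ} {F : Type} [NormedAddCommGroup F] [InnerProductSpace ℂ F]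
    [CompleteSpace F] (R : Fin n → F →L[ℂ] F) (μ : ↥(opSys R) →ₗ[ℂ] ℂ) :
    Word n → ℂ :=
  fun α => μ (elR R (revWord α))

section words
variable {n : ℕ}

lemma wordLen_word {k : ℕ} (f : Fin k → Fin n) : wordLen (word f) = k := by
  simp [wordLen, word]

lemma word_surj (α : Word n) : ∃ f : Fin (wordLen α) → Fin n, word f = α := by
  refine ⟨(FreeMonoid.toList α).get, ?_⟩
  unfold word wordLen
  rw [List.ofFn_get]; rfl

lemma word_inj {k : ℕ} : Function.Injective (word : (Fin k → Fin n) → Word n) := by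
  intro f g h
  exact List.ofFn_injective (FreeMonoid.ofList.injective h)

@[simp] lemma wordLen_mul (α β : Word n) : wordLen (α * β) = wordLen α + wordLen β := by
  simp [wordLen]
@[simp] lemma wordLen_one : wordLen (1 : Word n) = 0 := by simp [wordLen]
@[simp] lemma wordLen_of (i : Fin n) : wordLen (FreeMonoid.of i) = 1 := by simp [wordLen]
@[simp] lemma wordLen_rev (α : Word n) : wordLen (revWord α) = wordLen α := by
  simp [wordLen, revWord]

lemma wordLen_eq_zero {α : Word n} (h : wordLen α = 0) : α = 1 := by
  unfold wordLen at h
  exact FreeMonoid.toList.injective (List.length_eq_zero_iff.mp h)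

@[simp] lemma rev_rev (α : Word n) : revWord (revWord α) = α := by
  simp [revWord]
@[simp] lemma rev_one : revWord (1 : Word n) = 1 := by simp [revWord]
@[simp] lemma rev_of (i : Fin n) : revWord (FreeMonoid.of i) = FreeMonoid.of i := by
  simp [revWord, FreeMonoid.toList_of]
lemma rev_mul (α β : Word n) : revWord (α * β) = revWord β * revWord α := by
  simp [revWord]

lemma word_zero (f : Fin 0 → Fin n) : word f = 1 := by simp [word]
lemma word_cons {k : ℕ} (i : Fin n) (f : Fin k → Fin n) :
    word (Fin.cons i f : Fin (k+1) → Fin n) = FreeMonoid.of i * word f := by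
  simp [word, List.ofFn_succ, FreeMonoid.ofList_cons]
lemma word_rev {k : ℕ} (f : Fin k → Fin n) : word (f ∘ Fin.rev) = revWord (word f) := by
  unfold word revWord
  congr 1
  apply List.ext_getElem
  · simp
  · intro i h1 h2
    simp at h1
    simp only [List.getElem_ofFn, Function.comp, FreeMonoid.toList_ofList, List.getElem_reverse]
    congr 1
    ext
    simp [Fin.rev]
    omega

lemma sum_level_cons {M : Type*} [AddCommMonoid M] (k : ℕ) (G : Word n → M) :
    ∑ f : Fin (k+1) → Fin n, G (word f)
      = ∑ i, ∑ f : Fin k → Fin n, G (FreeMonoid.of i * word f) := by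
  rw [← (Fin.consEquiv (fun _ : Fin (k+1) => Fin n)).sum_comp, Fintype.sum_prod_type]
  refine Finset.sum_congr rfl fun i _ => Finset.sum_congr rfl fun f _ => ?_
  rw [← word_cons]; rfl

lemma sum_level_rev {M : Type*} [AddCommMonoid M] (k : ℕ) (G : Word n → M) :
    ∑ f : Fin k → Fin n, G (revWord (word f)) = ∑ f : Fin k → Fin n, G (word f) := by
  refine Fintype.sum_equiv (Equiv.arrowCongr Fin.revPerm (Equiv.refl _)) _ _ fun f => ?_
  rw [← word_rev]; rfl

open Classical in
/-- words of length `< N` -/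
def wB (n N : ℕ) : Finset (Word n) :=
  (Finset.range N).biUnion fun k => (Finset.univ : Finset (Fin k → Fin n)).image word

lemma mem_wB {N : ℕ} {α : Word n} : α ∈ wB n N ↔ wordLen α < N := by
  unfold wB
  simp only [Finset.mem_biUnion, Finset.mem_range, Finset.mem_image, Finset.mem_univ, true_and]
  constructor
  · rintro ⟨k, hk, f, rfl⟩; rwa [wordLen_word]
  · intro h
    obtain ⟨f, hf⟩ := word_surj α
    exact ⟨_, h, f, hf⟩

open Classical in
lemma sum_wB {M : Type*} [AddCommMonoid M] (N : ℕ) (G : Word n → M) :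
    ∑ α ∈ wB n N, G α = ∑ k ∈ Finset.range N, ∑ f : Fin k → Fin n, G (word f) := by
  unfold wB
  rw [Finset.sum_biUnion]
  · refine Finset.sum_congr rfl fun k _ => ?_
    rw [Finset.sum_image (fun f _ g _ h => word_inj h)]
  · intro i _ j _ hij
    rw [Function.onFun, Finset.disjoint_left]
    intro α h1 h2
    simp only [Finset.mem_image, Finset.mem_univ, true_and] at h1 h2
    obtain ⟨f, rfl⟩ := h1
    obtain ⟨g, hg⟩ := h2
    apply hij
    rw [← wordLen_word f, ← hg, wordLen_word]

lemma sum_wB_cons {M : Type*} [AddCommMonoid M] (N : ℕ) (G : Word n → M) :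
    ∑ α ∈ wB n (N+1), G α = (∑ α ∈ wB n N, ∑ i, G (FreeMonoid.of i * α)) + G 1 := by
  rw [sum_wB, sum_wB, Finset.sum_range_succ']
  congr 1
  · refine Finset.sum_congr rfl fun k _ => ?_
    rw [sum_level_cons, Finset.sum_comm]
  · simp [word_zero]

lemma sum_wB_rev {M : Type*} [AddCommMonoid M] (N : ℕ) (G : Word n → M) :
    ∑ α ∈ wB n N, G (revWord α) = ∑ α ∈ wB n N, G α := by
  rw [sum_wB, sum_wB]
  exact Finset.sum_congr rfl fun k _ => sum_level_rev k G

lemma sum_wB_snoc {M : Type*} [AddCommMonoid M] (N : ℕ) (G : Word n → M) :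
    ∑ α ∈ wB n (N+1), G α = (∑ α ∈ wB n N, ∑ i, G (α * FreeMonoid.of i)) + G 1 := by
  rw [← sum_wB_rev, sum_wB_cons, ← sum_wB_rev N]
  simp [rev_mul]

lemma sum_wB_mono {M : Type*} [AddCommMonoid M] {N N' : ℕ} (h : N ≤ N') (G : Word n → M)
    (hG : ∀ α, N ≤ wordLen α → G α = 0) :
    ∑ α ∈ wB n N', G α = ∑ α ∈ wB n N, G α := by
  symm
  apply Finset.sum_subset
  · intro α; rw [mem_wB, mem_wB]; omega
  · intro α _ h2; apply hG; rw [mem_wB] at h2; omega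

variable {K : Type} [NormedAddCommGroup K] [InnerProductSpace ℂ K]

lemma clm_mul_apply (A B : K →L[ℂ] K) (x : K) : (A * B) x = A (B x) := rfl

@[simp] lemma wordProd_one (X : Fin n → K →L[ℂ] K) : wordProd X 1 = 1 := by simp [wordProd]
@[simp] lemma wordProd_of (X : Fin n → K →L[ℂ] K) (i : Fin n) :
    wordProd X (FreeMonoid.of i) = X i := by simp [wordProd, FreeMonoid.toList_of]
lemma wordProd_mul (X : Fin n → K →L[ℂ] K) (α β : Word n) :
    wordProd X (α * β) = wordProd X α * wordProd X β := by simp [wordProd]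

end words

section est
variable {n : ℕ} {K : Type} [NormedAddCommGroup K] [InnerProductSpace ℂ K] [CompleteSpace K]

def rowC (ρ : ℝ) (X : Fin n → K →L[ℂ] K) : Prop :=
  ∀ z : K, ∑ i, ‖adjoint (X i) z‖ ^ 2 ≤ ρ ^ 2 * ‖z‖ ^ 2

lemma inBall_rowC {X : Fin n → K →L[ℂ] K} (h : inBall 1 X) :
    ∃ ρ : ℝ, 0 ≤ ρ ∧ ρ < 1 ∧ rowC ρ X := by
  unfold inBall at h
  refine ⟨√‖∑ i, X i * adjoint (X i)‖, Real.sqrt_nonneg _, ?_, ?_⟩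
  · rw [Real.sqrt_lt' one_pos]; exact h
  · intro z
    rw [Real.sq_sqrt (norm_nonneg _)]
    have h1 : (((∑ i, ‖adjoint (X i) z‖ ^ 2 : ℝ)) : ℂ)
        = inner ℂ z ((∑ i, X i * adjoint (X i)) z) := by
      rw [_root_.sum_apply, inner_sum]
      push_cast
      refine Finset.sum_congr rfl fun i _ => ?_
      rw [Function.comp_apply, ← adjoint_inner_left, inner_self_eq_norm_sq_to_K]
      rfl
    have h2 : ∑ i, ‖adjoint (X i) z‖ ^ 2 = ‖inner ℂ z ((∑ i, X i * adjoint (X i)) z)‖ := by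
      rw [← h1, Complex.norm_of_nonneg (by positivity)]
    rw [h2]
    calc _ ≤ ‖z‖ * ‖(∑ i, X i * adjoint (X i)) z‖ := norm_inner_le_norm _ _
      _ ≤ ‖z‖ * (‖∑ i, X i * adjoint (X i)‖ * ‖z‖) := by gcongr; exact le_opNorm _ _
      _ = _ := by ring

lemma level_row {ρ : ℝ} {X : Fin n → K →L[ℂ] K} (h : rowC ρ X) (k : ℕ) (z : K) :
    ∑ f : Fin k → Fin n, ‖adjoint (wordProd X (word f)) z‖ ^ 2 ≤ (ρ ^ k) ^ 2 * ‖z‖ ^ 2 := by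
  induction k generalizing z with
  | zero => simp [word_zero, ← ContinuousLinearMap.star_eq_adjoint]
  | succ k ih =>
    rw [sum_level_cons k (fun α => ‖adjoint (wordProd X α) z‖ ^ 2)]
    calc _ = ∑ i, ∑ f : Fin k → Fin n, ‖adjoint (wordProd X (word f)) (adjoint (X i) z)‖ ^ 2 := by
          refine Finset.sum_congr rfl fun i _ => Finset.sum_congr rfl fun f _ => ?_
          rw [wordProd_mul, wordProd_of, ← ContinuousLinearMap.star_eq_adjoint, star_mul]
          rfl
      _ ≤ ∑ i, (ρ ^ k) ^ 2 * ‖adjoint (X i) z‖ ^ 2 := Finset.sum_le_sum fun i _ => ih _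
      _ = (ρ ^ k) ^ 2 * ∑ i, ‖adjoint (X i) z‖ ^ 2 := by rw [Finset.mul_sum]
      _ ≤ (ρ ^ k) ^ 2 * (ρ ^ 2 * ‖z‖ ^ 2) := by gcongr; exact h z
      _ = _ := by ring

lemma norm_truncSum_le {ρ : ℝ} (hρ : 0 ≤ ρ) {X : Fin n → K →L[ℂ] K} (h : rowC ρ X)
    (a : Word n → ℂ) (k : ℕ) :
    ‖truncSum a X k‖ ≤ √(∑ f : Fin k → Fin n, ‖a (word f)‖ ^ 2) * ρ ^ k := by
  refine ContinuousLinearMap.opNorm_le_bound _ (by positivity) fun y => ?_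
  by_cases hz : truncSum a X k y = 0
  · rw [hz, norm_zero]; positivity
  have hz' : 0 < ‖truncSum a X k y‖ := norm_pos_iff.mpr hz
  set z := truncSum a X k y with hzdef
  have h1 : ‖z‖ * ‖z‖ ≤ √(∑ f : Fin k → Fin n, ‖a (word f)‖ ^ 2) * ρ ^ k * ‖y‖ * ‖z‖ := by
    calc ‖z‖ * ‖z‖ = ‖inner ℂ z z‖ := by rw [inner_self_eq_norm_sq_to_K]; simp [sq]
      _ = ‖∑ f : Fin k → Fin n, a (word f) * inner ℂ (adjoint (wordProd X (word f)) z) y‖ := by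
        congr 1
        conv_lhs => enter [3]; rw [hzdef]
        simp only [truncSum, _root_.sum_apply, inner_sum,
          _root_.smul_apply, inner_smul_right, adjoint_inner_left]
      _ ≤ ∑ f : Fin k → Fin n, ‖a (word f)‖ * (‖adjoint (wordProd X (word f)) z‖ * ‖y‖) := by
        refine (norm_sum_le _ _).trans (Finset.sum_le_sum fun f _ => ?_)
        rw [norm_mul]; gcongr; exact norm_inner_le_norm _ _
      _ = (∑ f : Fin k → Fin n, ‖a (word f)‖ * ‖adjoint (wordProd X (word f)) z‖) * ‖y‖ := by
        rw [Finset.sum_mul]; simp only [mul_assoc]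
      _ ≤ (√(∑ f : Fin k → Fin n, ‖a (word f)‖ ^ 2) *
            √(∑ f : Fin k → Fin n, ‖adjoint (wordProd X (word f)) z‖ ^ 2)) * ‖y‖ := by
        gcongr; exact Real.sum_mul_le_sqrt_mul_sqrt _ _ _
      _ ≤ (√(∑ f : Fin k → Fin n, ‖a (word f)‖ ^ 2) * (ρ ^ k * ‖z‖)) * ‖y‖ := by
        gcongr
        apply Real.sqrt_le_iff.mpr ⟨by positivity, ?_⟩
        rw [mul_pow]; exact level_row h k z
      _ = _ := by ring
  exact le_of_mul_le_mul_right h1 hz'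

lemma truncSumAdj_eq (b : Word n → ℂ) (X : Fin n → K →L[ℂ] K) (k : ℕ) :
    truncSumAdj b X k = adjoint (truncSum (fun α => star (b α)) X k) := by
  simp [truncSumAdj, truncSum, map_sum, ← ContinuousLinearMap.star_eq_adjoint, star_smul]

lemma norm_truncSumAdj_le {ρ : ℝ} (hρ : 0 ≤ ρ) {X : Fin n → K →L[ℂ] K} (h : rowC ρ X)
    (b : Word n → ℂ) (k : ℕ) :
    ‖truncSumAdj b X k‖ ≤ √(∑ f : Fin k → Fin n, ‖b (word f)‖ ^ 2) * ρ ^ k := by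
  rw [truncSumAdj_eq, ← ContinuousLinearMap.star_eq_adjoint, norm_star]
  simpa using norm_truncSum_le hρ h (fun α => star (b α)) k

lemma row_sum {ρ : ℝ} (hρ : 0 ≤ ρ) (hρ1 : ρ ≤ 1) {X : Fin n → K →L[ℂ] K} (h : rowC ρ X)
    (y : Fin n → K) : ‖∑ i, X i (y i)‖ ^ 2 ≤ ∑ i, ‖y i‖ ^ 2 := by
  set z := ∑ i, X i (y i) with hz
  have h1 : ‖z‖ ^ 2 ≤ ∑ i, ‖adjoint (X i) z‖ * ‖y i‖ := by
    calc ‖z‖ ^ 2 = ‖inner ℂ z z‖ := by rw [inner_self_eq_norm_sq_to_K]; simp [sq]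
      _ = ‖∑ i, inner ℂ (adjoint (X i) z) (y i)‖ := by
        simp only [adjoint_inner_left]; rw [← inner_sum, ← hz]
      _ ≤ _ := (norm_sum_le _ _).trans (Finset.sum_le_sum fun f _ => norm_inner_le_norm _ _)
  have h2 : ∑ i, ‖adjoint (X i) z‖ * ‖y i‖ ≤ (∑ i, ‖adjoint (X i) z‖ ^ 2 + ∑ i, ‖y i‖ ^ 2) / 2 := by
    rw [← Finset.sum_add_distrib, Finset.sum_div]
    refine Finset.sum_le_sum fun i _ => ?_
    nlinarith [sq_nonneg (‖adjoint (X i) z‖ - ‖y i‖)]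
  have h3 := h z
  have h4 : ρ ^ 2 * ‖z‖ ^ 2 ≤ ‖z‖ ^ 2 := by
    have : ρ ^ 2 ≤ 1 := by nlinarith
    nlinarith [sq_nonneg ‖z‖]
  linarith

/-- growth from the radius condition -/
lemma radCond_growth {a : Word n → ℂ} (h : radCond 1 a) {c : ℝ} (hc : 1 < c) :
    ∀ᶠ k : ℕ in atTop, √(∑ f : Fin k → Fin n, ‖a (word f)‖ ^ 2) ≤ c ^ k := by
  unfold radCond at h
  have h1 : Filter.limsup
    (fun k : ℕ =>
      (∑ f : Fin k → Fin n, (‖a (word f)‖₊ : ℝ≥0∞) ^ 2) ^ ((1 : ℝ) / (2 * (k : ℝ))))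
    Filter.atTop < ENNReal.ofReal c := by
    refine lt_of_le_of_lt h ?_
    rw [ENNReal.ofReal_lt_ofReal_iff (by linarith)]; simpa using hc
  filter_upwards [Filter.eventually_lt_of_limsup_lt h1, eventually_gt_atTop 0] with k hk hk0
  have hk0' : (0:ℝ) < 2 * k := by positivity
  have h2 : (∑ f : Fin k → Fin n, (‖a (word f)‖₊ : ℝ≥0∞) ^ 2) ≤ ENNReal.ofReal c ^ (2 * (k:ℝ)) := by
    have := ENNReal.rpow_le_rpow hk.le hk0'.le
    rwa [← ENNReal.rpow_mul, one_div, inv_mul_cancel₀ hk0'.ne', ENNReal.rpow_one] at this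
  have h3 : (∑ f : Fin k → Fin n, (‖a (word f)‖₊ : ℝ≥0∞) ^ 2)
      = ENNReal.ofReal (∑ f : Fin k → Fin n, ‖a (word f)‖ ^ 2) := by
    rw [ENNReal.ofReal_sum_of_nonneg (fun _ _ => by positivity)]
    refine Finset.sum_congr rfl fun f _ => ?_
    rw [ENNReal.ofReal_pow (norm_nonneg _), ofReal_norm]; rfl
  have h4 : ENNReal.ofReal c ^ (2 * (k:ℝ)) = ENNReal.ofReal ((c ^ k) ^ 2) := by
    rw [show (2 * (k:ℝ)) = ((k * 2 : ℕ) : ℝ) by push_cast; ring, ENNReal.rpow_natCast,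
      ← ENNReal.ofReal_pow (by linarith), pow_mul]
  rw [h3, h4, ENNReal.ofReal_le_ofReal_iff (by positivity)] at h2
  exact Real.sqrt_le_iff.mpr ⟨by positivity, h2⟩

lemma summable_aux {g : ℕ → ℝ} {s : ℕ → ℝ} {ρ : ℝ} (hρ : 0 ≤ ρ) (hρ1 : ρ < 1)
    (hs : ∀ c : ℝ, 1 < c → ∀ᶠ k in atTop, s k ≤ c ^ k)
    (hg0 : ∀ k, 0 ≤ g k) (hg : ∀ k, g k ≤ s k * ρ ^ k) : Summable g := by
  obtain ⟨c, hc1, hc2⟩ : ∃ c : ℝ, 1 < c ∧ c * ρ < 1 := by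
    refine ⟨2 / (1 + ρ), ?_, ?_⟩
    · rw [lt_div_iff₀ (by linarith)]; linarith
    · rw [div_mul_eq_mul_div, div_lt_one (by linarith)]; linarith
  refine Summable.of_norm_bounded_eventually_nat
    (summable_geometric_of_lt_one (by positivity) hc2) ?_
  filter_upwards [hs c hc1] with k hk
  rw [Real.norm_of_nonneg (hg0 k), mul_pow]
  exact (hg k).trans (by gcongr)

lemma summable_truncSum {a : Word n → ℂ} (h : radCond 1 a) {ρ : ℝ} (hρ : 0 ≤ ρ) (hρ1 : ρ < 1)
    {X : Fin n → K →L[ℂ] K} (hX : rowC ρ X) : Summable fun k => truncSum a X k :=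
  Summable.of_norm (summable_aux hρ hρ1 (fun _ hc => radCond_growth h hc) (fun _ => norm_nonneg _)
    (fun k => norm_truncSum_le hρ hX a k))

lemma summable_truncSumAdj {a : Word n → ℂ} (h : radCond 1 a) {ρ : ℝ} (hρ : 0 ≤ ρ) (hρ1 : ρ < 1)
    {X : Fin n → K →L[ℂ] K} (hX : rowC ρ X) : Summable fun k => truncSumAdj a X k :=
  Summable.of_norm (summable_aux hρ hρ1 (fun _ hc => radCond_growth h hc) (fun _ => norm_nonneg _)
    (fun k => norm_truncSumAdj_le hρ hX a k))

lemma radCond_of_bound {a : Word n → ℂ} {C : ℝ}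
    (h : ∀ k, ∑ f : Fin k → Fin n, ‖a (word f)‖ ^ 2 ≤ C) : radCond 1 a := by
  unfold radCond
  have hb : ∀ k : ℕ, (∑ f : Fin k → Fin n, (‖a (word f)‖₊ : ℝ≥0∞) ^ 2) ^ ((1 : ℝ) / (2 * (k : ℝ)))
      ≤ ENNReal.ofReal (max C 1) ^ ((1 : ℝ) / (2 * (k : ℝ))) := by
    intro k
    apply ENNReal.rpow_le_rpow _ (by positivity)
    have h3 : (∑ f : Fin k → Fin n, (‖a (word f)‖₊ : ℝ≥0∞) ^ 2)
      = ENNReal.ofReal (∑ f : Fin k → Fin n, ‖a (word f)‖ ^ 2) := by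
      rw [ENNReal.ofReal_sum_of_nonneg (fun _ _ => by positivity)]
      refine Finset.sum_congr rfl fun f _ => ?_
      rw [ENNReal.ofReal_pow (norm_nonneg _), ofReal_norm]; rfl
    rw [h3]
    exact ENNReal.ofReal_le_ofReal ((h k).trans (le_max_left _ _))
  have ht : Tendsto (fun k : ℕ => ENNReal.ofReal (max C 1) ^ ((1 : ℝ) / (2 * (k : ℝ)))) atTop
      (nhds 1) := by
    have h0 : Tendsto (fun k : ℕ => (1 : ℝ) / (2 * (k : ℝ))) atTop (nhds 0) := by
      refine Tendsto.div_atTop tendsto_const_nhds ?_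
      exact Tendsto.const_mul_atTop (by norm_num) tendsto_natCast_atTop_atTop
    have h1 : Tendsto (fun k : ℕ => (max C 1) ^ ((1 : ℝ) / (2 * (k : ℝ)))) atTop (nhds 1) := by
      have := (Real.continuous_const_rpow (a := max C 1) (by positivity)).tendsto 0
      rw [Real.rpow_zero] at this
      exact this.comp h0
    have h2 := ENNReal.tendsto_ofReal h1
    rw [ENNReal.ofReal_one] at h2
    refine h2.congr fun k => ?_
    rw [ENNReal.ofReal_rpow_of_pos (by positivity)]
  calc _ ≤ Filter.limsup (fun k : ℕ => ENNReal.ofReal (max C 1) ^ ((1 : ℝ) / (2 * (k : ℝ)))) atTop :=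
        Filter.limsup_le_limsup (Eventually.of_forall hb)
    _ = 1 := ht.limsup_eq
    _ ≤ _ := by simp

end est

section phi
variable {n : ℕ} {F : Type} [NormedAddCommGroup F] [InnerProductSpace ℂ F]
  {H : Type} [NormedAddCommGroup H] [InnerProductSpace ℂ H]

def phi (e : Word n → F) (s : Finset (Word n)) (x : Word n → H) : (F →L[ℂ] F) →ₗ[ℂ] ℂ where
  toFun T := ∑ γ ∈ s, ∑ β ∈ s, inner ℂ (e γ) (T (e β)) * inner ℂ (x γ) (x β)
  map_add' S T := by
    simp only [← Finset.sum_add_distrib, _root_.add_apply, inner_add_right, add_mul]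
  map_smul' c T := by
    simp only [Finset.mul_sum, _root_.smul_apply, inner_smul_right, RingHom.id_apply,
      smul_eq_mul, mul_assoc]

lemma phi_apply (e : Word n → F) (s : Finset (Word n)) (x : Word n → H) (T : F →L[ℂ] F) :
    phi e s x T = ∑ γ ∈ s, ∑ β ∈ s, inner ℂ (e γ) (T (e β)) * inner ℂ (x γ) (x β) := rfl

lemma phi_pos [CompleteSpace F] (e : Word n → F) (s : Finset (Word n)) (x : Word n → H) (T : F →L[ℂ] F)
    (hT : T.IsPositive) : 0 ≤ phi e s x T := by
  classical
  rw [phi_apply]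
  obtain ⟨S, hS⟩ := CStarAlgebra.nonneg_iff_eq_star_mul_self.mp
    ((ContinuousLinearMap.nonneg_iff_isPositive T).mpr hT)
  have hG := Matrix.posSemidef_gram ℂ (fun β : s => x β)
  have hA := Matrix.posSemidef_gram ℂ (fun β : s => S (e β))
  have h := (hA.hadamard hG).dotProduct_mulVec_nonneg (fun _ => 1)
  have h2 : ∑ γ ∈ s, ∑ β ∈ s, inner ℂ (e γ) (T (e β)) * inner ℂ (x γ) (x β)
      = ∑ γ : s, ∑ β : s, inner ℂ (S (e γ)) (S (e β)) * inner ℂ (x γ) (x β) := by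
    rw [← Finset.sum_coe_sort s]
    refine Finset.sum_congr rfl fun γ _ => ?_
    rw [← Finset.sum_coe_sort s]
    refine Finset.sum_congr rfl fun β _ => ?_
    rw [hS, clm_mul_apply, ContinuousLinearMap.star_eq_adjoint, adjoint_inner_right]
  rw [h2]
  simpa [dotProduct, Matrix.mulVec, Matrix.gram, Matrix.hadamard] using h

lemma phi_adjoint [CompleteSpace F] (e : Word n → F) (s : Finset (Word n)) (x : Word n → H)
    (T : F →L[ℂ] F) : phi e s x (adjoint T) = star (phi e s x T) := by
  rw [phi_apply, phi_apply, Finset.sum_comm]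
  simp only [star_sum, star_mul']
  refine Finset.sum_congr rfl fun γ _ => Finset.sum_congr rfl fun β _ => ?_
  rw [adjoint_inner_right]
  simp

end phi

section iso
variable {n : ℕ} {H : Type} [NormedAddCommGroup H] [InnerProductSpace ℂ H] [CompleteSpace H]

def isoFam (V : Fin n → H →L[ℂ] H) : Prop :=
  ∀ i j, adjoint (V i) * V j = if i = j then 1 else 0

lemma isoFam_apply {V : Fin n → H →L[ℂ] H} (hV : isoFam V) (i j : Fin n) (x : H) :
    adjoint (V i) (V j x) = if i = j then x else 0 := by
  have := congrArg (fun A : H →L[ℂ] H => A x) (hV i j)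
  simp only [clm_mul_apply] at this
  rw [this]; split_ifs <;> rfl

lemma isoFam_E {V : Fin n → H →L[ℂ] H} (hV : isoFam V) (x y : H) :
    inner ℂ (x - ∑ i, V i (adjoint (V i) x)) (y - ∑ i, V i (adjoint (V i) y))
      = inner ℂ x y - ∑ i, inner ℂ (adjoint (V i) x) (adjoint (V i) y) := by
  simp only [inner_sub_left, inner_sub_right, inner_sum, sum_inner]
  have h1 : ∀ i, inner ℂ x (V i (adjoint (V i) y)) = inner ℂ (adjoint (V i) x) (adjoint (V i) y) := by
    intro i; rw [adjoint_inner_left]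
  have h2 : ∀ i, inner ℂ (V i (adjoint (V i) x)) y = inner ℂ (adjoint (V i) x) (adjoint (V i) y) := by
    intro i; rw [adjoint_inner_right]
  have h3 : ∀ i j, inner ℂ (V i (adjoint (V i) x)) (V j (adjoint (V j) y))
      = if i = j then inner ℂ (adjoint (V i) x) (adjoint (V i) y) else 0 := by
    intro i j
    rw [← adjoint_inner_right, isoFam_apply hV]
    split_ifs with h
    · rw [h]
    · simp
  simp only [h1, h2, h3]
  simp

lemma isoFam_row {V : Fin n → H →L[ℂ] H} (hV : isoFam V) : rowC 1 V := by
  intro z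
  have h := congrArg Complex.re (isoFam_E hV z z)
  rw [Complex.sub_re, Complex.re_sum] at h
  have e1 : ∀ w : H, (inner ℂ w w).re = ‖w‖ ^ 2 := fun w => by
    rw [inner_self_eq_norm_sq_to_K]; simp [← Complex.ofReal_pow]
  simp only [e1] at h
  nlinarith [sq_nonneg ‖z - ∑ i, V i (adjoint (V i) z)‖]

end iso

section fejer
variable {n : ℕ} {F : Type} [NormedAddCommGroup F] [InnerProductSpace ℂ F] [CompleteSpace F]
  {H : Type} [NormedAddCommGroup H] [InnerProductSpace ℂ H] [CompleteSpace H]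

lemma R_e {e : Word n → F} {R : Fin n → F →L[ℂ] F}
    (hR : ∀ (i : Fin n) (α : Word n), R i (e α) = e (α * FreeMonoid.of i)) (α β : Word n) :
    wordProd R (revWord α) (e β) = e (β * α) := by
  induction α using FreeMonoid.inductionOn' generalizing β with
  | one => simp
  | of_mul i α ih =>
    rw [rev_mul, wordProd_mul, clm_mul_apply, rev_of, wordProd_of, hR, ih, mul_assoc]

/-- value of `phi` on shifts -/
lemma phi_R {e : Word n → F} (he : Orthonormal ℂ e) {R : Fin n → F →L[ℂ] F}
    (hR : ∀ (i : Fin n) (α : Word n), R i (e α) = e (α * FreeMonoid.of i))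
    (t : ℕ) (x : Word n → H) (α : Word n) :
    phi e (wB n t) x (wordProd R (revWord α))
      = ∑ β ∈ wB n (t - wordLen α), inner ℂ (x (β * α)) (x β) := by
  classical
  rw [phi_apply, Finset.sum_comm]
  simp only [R_e hR, orthonormal_iff_ite.mp he, ite_mul, one_mul, zero_mul, Finset.sum_ite_eq',
    mem_wB, wordLen_mul]
  rw [← Finset.sum_filter]
  refine Finset.sum_congr ?_ fun _ _ => rfl
  ext β
  simp only [Finset.mem_filter, mem_wB]
  omega

def xfam (V : Fin n → H →L[ℂ] H) (h : H) (β : Word n) : H :=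
  adjoint (wordProd V (revWord β)) h

lemma xfam_cons (V : Fin n → H →L[ℂ] H) (h : H) (i : Fin n) (β : Word n) :
    xfam V h (FreeMonoid.of i * β) = adjoint (V i) (xfam V h β) := by
  unfold xfam
  rw [rev_mul, wordProd_mul, rev_of, wordProd_of, ← ContinuousLinearMap.star_eq_adjoint, star_mul]
  rfl

def yfam (V : Fin n → H →L[ℂ] H) (h : H) (β : Word n) : H :=
  xfam V h β - ∑ i, V i (adjoint (V i) (xfam V h β))

def fej (e : Word n → F) (V : Fin n → H →L[ℂ] H) (h : H) (N : ℕ) : (F →L[ℂ] F) →ₗ[ℂ] ℂ :=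
  ((N : ℂ)⁻¹) • (phi e (wB n N) (xfam V h) + ∑ t ∈ Finset.range N, phi e (wB n t) (yfam V h))

lemma fej_pos (e : Word n → F) (V : Fin n → H →L[ℂ] H) (h : H) (N : ℕ) (T : F →L[ℂ] F)
    (hT : T.IsPositive) : 0 ≤ fej e V h N T := by
  unfold fej
  simp only [LinearMap.smul_apply, LinearMap.add_apply, LinearMap.sum_apply, smul_eq_mul]
  refine mul_nonneg ?_ (add_nonneg (phi_pos _ _ _ _ hT) (Finset.sum_nonneg fun t _ => phi_pos _ _ _ _ hT))
  rw [inv_nonneg]; exact_mod_cast Nat.zero_le N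

lemma fej_adjoint (e : Word n → F) (V : Fin n → H →L[ℂ] H) (h : H) (N : ℕ) (T : F →L[ℂ] F) :
    fej e V h N (adjoint T) = star (fej e V h N T) := by
  unfold fej
  simp [LinearMap.smul_apply, LinearMap.add_apply, LinearMap.sum_apply, smul_eq_mul, phi_adjoint]

lemma fej_R {e : Word n → F} (he : Orthonormal ℂ e) {R : Fin n → F →L[ℂ] F}
    (hR : ∀ (i : Fin n) (α : Word n), R i (e α) = e (α * FreeMonoid.of i))
    {V : Fin n → H →L[ℂ] H} (hV : isoFam V) (h : H) (N : ℕ) (α : Word n) :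
    fej e V h N (wordProd R (revWord α))
      = (N : ℂ)⁻¹ * ((N - wordLen α : ℕ) : ℂ) * inner ℂ h (wordProd V (revWord α) h) := by
  unfold fej
  simp only [LinearMap.smul_apply, LinearMap.add_apply, LinearMap.sum_apply, smul_eq_mul,
    phi_R he hR, mul_assoc]
  congr 1
  set G : Word n → ℂ := fun β => inner ℂ (xfam V h (β * α)) (xfam V h β) with hG
  have hG1 : G 1 = inner ℂ h (wordProd V (revWord α) h) := by
    simp only [hG, one_mul]
    unfold xfam
    rw [adjoint_inner_left]
    simp [← ContinuousLinearMap.star_eq_adjoint]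
  have hE : ∀ m, ∑ β ∈ wB n m, inner ℂ (yfam V h (β * α)) (yfam V h β)
      = (∑ β ∈ wB n m, G β) - (∑ β ∈ wB n (m+1), G β) + G 1 := by
    intro m
    rw [sum_wB_cons m G]
    have : ∀ β, inner ℂ (yfam V h (β * α)) (yfam V h β)
        = G β - ∑ i, G (FreeMonoid.of i * β) := by
      intro β
      unfold yfam
      rw [isoFam_E hV]
      simp only [hG, mul_assoc, xfam_cons]
    simp only [this, Finset.sum_sub_distrib]
    ring
  simp only [hE]
  rw [← hG1]
  generalize wordLen α = l
  clear hE
  have h0 : ∀ N : ℕ, (∑ β ∈ wB n (N - l), G β) + ∑ t ∈ Finset.range N, ((∑ β ∈ wB n (t - l), G β) -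
      (∑ β ∈ wB n (t - l + 1), G β) + G 1) = ((N - l : ℕ) : ℂ) * G 1 := by
    intro N
    induction N with
    | zero => simp [sum_wB]
    | succ N ih =>
      rw [Finset.sum_range_succ]
      rcases le_or_gt l N with hl | hl
      · rw [show N + 1 - l = N - l + 1 by omega]
        push_cast
        rw [add_mul, ← ih]; ring
      · have e1 : N - l = 0 := by omega
        have e2 : N + 1 - l = 0 := by omega
        rw [e1] at ih ⊢
        rw [e2]
        have : ∑ β ∈ wB n (0+1), G β = G 1 := by rw [sum_wB_cons]; simp [sum_wB]
        rw [this]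
        have : ∑ β ∈ wB n 0, G β = 0 := by simp [sum_wB]
        rw [this] at ih ⊢
        rw [← ih]; ring
  exact h0 N

end fejer

section basis
variable {n : ℕ} {F : Type} [NormedAddCommGroup F] [InnerProductSpace ℂ F]

lemma vec_ext {ι : Type} (e : HilbertBasis ι ℂ F) {x y : F}
    (h : ∀ β, inner ℂ (e β) x = inner ℂ (e β) y) : x = y := by
  apply e.repr.injective
  ext β
  rw [e.repr_apply_apply, e.repr_apply_apply, h]

lemma clm_ext {ι : Type} (e : HilbertBasis ι ℂ F) {A B : F →L[ℂ] F}
    (h : ∀ β, A (e β) = B (e β)) : A = B := by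
  refine ContinuousLinearMap.ext_on (s := Set.range e) ?_ ?_
  · have := e.dense_span
    rw [dense_iff_closure_eq, ← Submodule.topologicalClosure_coe, this]; rfl
  · rintro _ ⟨β, rfl⟩; exact h β

lemma isoFam_shift [CompleteSpace F] (e : HilbertBasis (Word n) ℂ F) (σ : Fin n → Word n → Word n)
    (hσ : ∀ i j α β, σ i α = σ j β ↔ i = j ∧ α = β)
    (S : Fin n → F →L[ℂ] F) (hS : ∀ i α, S i (e α) = e (σ i α)) : isoFam S := by
  classical
  intro i j
  refine clm_ext e fun α => vec_ext e fun β => ?_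
  rw [clm_mul_apply, adjoint_inner_right, hS, hS, orthonormal_iff_ite.mp e.orthonormal]
  simp only [hσ]
  by_cases hij : i = j
  · simp [hij, orthonormal_iff_ite.mp e.orthonormal]
  · simp [hij]

lemma snoc_inj (i j : Fin n) (α β : Word n) :
    α * FreeMonoid.of i = β * FreeMonoid.of j ↔ i = j ∧ α = β := by
  constructor
  · intro h
    have h' : FreeMonoid.toList α ++ [i] = FreeMonoid.toList β ++ [j] := h
    have := List.append_inj' h' rfl
    exact ⟨by simpa using this.2, this.1⟩
  · rintro ⟨rfl, rfl⟩; rfl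

lemma cons_inj (i j : Fin n) (α β : Word n) :
    FreeMonoid.of i * α = FreeMonoid.of j * β ↔ i = j ∧ α = β := by
  constructor
  · intro h
    have h' : i :: FreeMonoid.toList α = j :: FreeMonoid.toList β := h
    exact ⟨(List.cons.inj h').1, (List.cons.inj h').2⟩
  · rintro ⟨rfl, rfl⟩; rfl

lemma exists_L [CompleteSpace F] (e : HilbertBasis (Word n) ℂ F) :
    ∃ L : Fin n → F →L[ℂ] F, ∀ i α, L i (e α) = e (FreeMonoid.of i * α) := by
  classical
  have ho : ∀ i : Fin n, Orthonormal ℂ (fun α : Word n => e (FreeMonoid.of i * α)) := fun i =>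
    e.orthonormal.comp _ (fun α β h => ((cons_inj i i α β).mp h).2)
  refine ⟨fun i => (ho i).orthogonalFamily.linearIsometry.toContinuousLinearMap ∘L
    (e.repr.toLinearIsometry.toContinuousLinearMap), fun i α => ?_⟩
  have : e.repr (e α) = lp.single 2 α (1:ℂ) := e.repr_self α
  simp only [ContinuousLinearMap.comp_apply, LinearIsometry.coe_toContinuousLinearMap,
    LinearIsometryEquiv.coe_toLinearIsometry, this]
  rw [OrthogonalFamily.linearIsometry_apply_single]
  simp

end basis

section toep
variable {n : ℕ} {F : Type} [NormedAddCommGroup F] [InnerProductSpace ℂ F] [CompleteSpace F]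

def toep (R : Fin n → F →L[ℂ] F) (Y : F →L[ℂ] F) : Prop :=
  ∀ i j, adjoint (R i) * Y * R j = if i = j then Y else 0

lemma toep_add {R : Fin n → F →L[ℂ] F} {Y Z : F →L[ℂ] F} (hY : toep R Y) (hZ : toep R Z) :
    toep R (Y + Z) := by
  intro i j
  rw [mul_add, add_mul, hY, hZ]; split_ifs <;> simp

lemma toep_smul {R : Fin n → F →L[ℂ] F} {Y : F →L[ℂ] F} (c : ℂ) (hY : toep R Y) :
    toep R (c • Y) := by
  intro i j
  rw [mul_smul_comm, smul_mul_assoc, hY]; split_ifs <;> simp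

lemma toep_sum {R : Fin n → F →L[ℂ] F} {ι : Type} (s : Finset ι) {Y : ι → F →L[ℂ] F}
    (hY : ∀ k, toep R (Y k)) : toep R (∑ k ∈ s, Y k) := by
  intro i j
  rw [Finset.mul_sum, Finset.sum_mul]
  simp only [hY _ i j]; split_ifs <;> simp

lemma toep_tsum {R : Fin n → F →L[ℂ] F} {Y : ℕ → F →L[ℂ] F} (hs : Summable Y)
    (hY : ∀ k, toep R (Y k)) : toep R (∑' k, Y k) := by
  intro i j
  rw [← hs.tsum_mul_left, ← (hs.mul_left _).tsum_mul_right]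
  simp only [hY _ i j]; split_ifs <;> simp

lemma toep_adjoint {R : Fin n → F →L[ℂ] F} {Y : F →L[ℂ] F} (hY : toep R Y) :
    toep R (adjoint Y) := by
  intro i j
  have := congrArg star (hY j i)
  rw [star_mul, star_mul] at this
  simp only [ContinuousLinearMap.star_eq_adjoint, adjoint_adjoint] at this
  rw [mul_assoc, this]
  by_cases h : i = j
  · simp [h]
  · simp [h, Ne.symm h]

lemma toep_one {R : Fin n → F →L[ℂ] F} (hR : isoFam R) : toep R 1 := by
  intro i j; rw [mul_one]; exact hR i j

lemma toep_of_comm {R : Fin n → F →L[ℂ] F} (hR : isoFam R) {Y : F →L[ℂ] F}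
    (hY : ∀ j, Y * R j = R j * Y) : toep R Y := by
  intro i j
  rw [mul_assoc, hY, ← mul_assoc, hR i j]; split_ifs <;> simp

lemma comm_wordProd {X R : Fin n → F →L[ℂ] F} (h : ∀ i j, X i * R j = R j * X i) (α : Word n)
    (j : Fin n) : wordProd X α * R j = R j * wordProd X α := by
  induction α using FreeMonoid.inductionOn' with
  | one => simp
  | of_mul i α ih =>
    rw [wordProd_mul, wordProd_of, mul_assoc, ih, ← mul_assoc, h, mul_assoc]

lemma toep_phOp {X R : Fin n → F →L[ℂ] F} (hR : isoFam R) (h : ∀ i j, X i * R j = R j * X i)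
    {a b : Word n → ℂ} (hs : Summable fun k => truncSum a X k)
    (hs' : Summable fun k => truncSumAdj b X k) : toep R (phOp a b X) := by
  have hw : ∀ α, toep R (wordProd X α) := fun α => toep_of_comm hR (comm_wordProd h α)
  unfold phOp
  refine toep_add (toep_add (toep_tsum ((summable_nat_add_iff 1).mpr hs') fun k => ?_)
    (toep_smul _ (toep_one hR))) (toep_tsum ((summable_nat_add_iff 1).mpr hs) fun k => ?_)
  · exact toep_sum _ fun f => toep_smul _ (toep_adjoint (hw _))
  · exact toep_sum _ fun f => toep_smul _ (hw _)

def coefL (x y : F) : (F →L[ℂ] F) →L[ℂ] ℂ := (innerSL ℂ x) ∘L (ContinuousLinearMap.apply ℂ F y)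

lemma coefL_apply (x y : F) (T : F →L[ℂ] F) : coefL x y T = inner ℂ x (T y) := by
  simp [coefL]

lemma inner_phOp {X : Fin n → F →L[ℂ] F} 
    {a b : Word n → ℂ} (hs : Summable fun k => truncSum a X k)
    (hs' : Summable fun k => truncSumAdj b X k) (x y : F) :
    inner ℂ x (phOp a b X y) = ∑' k, inner ℂ x (truncSumAdj b X (k+1) y) + a 1 * inner ℂ x y
      + ∑' k, inner ℂ x (truncSum a X (k+1) y) := by
  rw [← coefL_apply]
  unfold phOp
  rw [map_add, map_add, (coefL x y).map_tsum ((summable_nat_add_iff 1).mpr hs'),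
    (coefL x y).map_tsum ((summable_nat_add_iff 1).mpr hs), map_smul]
  simp only [coefL_apply]
  simp

lemma wordProd_rL {e : Word n → F} {L : Fin n → F →L[ℂ] F}
    (hL : ∀ i α, L i (e α) = e (FreeMonoid.of i * α)) (r : ℂ) (α β : Word n) :
    wordProd (fun i => r • L i) α (e β) = r ^ wordLen α • e (α * β) := by
  induction α using FreeMonoid.inductionOn' with
  | one => simp
  | of_mul i α ih =>
    rw [wordProd_mul, wordProd_of, clm_mul_apply, ih, map_smul, _root_.smul_apply, hL, smul_smul,
      wordLen_mul, wordLen_of, pow_add, pow_one, mul_assoc, mul_comm r]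

lemma coef_trunc {e : Word n → F} (he : Orthonormal ℂ e) {L : Fin n → F →L[ℂ] F}
    (hL : ∀ i α, L i (e α) = e (FreeMonoid.of i * α)) (r : ℂ) (a : Word n → ℂ) (k : ℕ) (α : Word n) :
    inner ℂ (e α) (truncSum a (fun i => r • L i) k (e 1))
      = if wordLen α = k then r ^ k * a α else 0 := by
  classical
  unfold truncSum
  rw [_root_.sum_apply, inner_sum]
  simp only [_root_.smul_apply, wordProd_rL hL, inner_smul_right, mul_one, wordLen_word,
    orthonormal_iff_ite.mp he]
  split_ifs with h
  · subst h
    obtain ⟨g, hg⟩ := word_surj α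
    rw [Finset.sum_eq_single g]
    · simp [hg, mul_comm]
    · intro f _ hf
      have : α ≠ word f := fun h => hf (word_inj (h.symm.trans hg.symm))
      simp [this]
    · simp
  · refine Finset.sum_eq_zero fun f _ => ?_
    have : α ≠ word f := by rintro rfl; exact h (wordLen_word f)
    simp [this]

lemma coef_trunc' {e : Word n → F} (he : Orthonormal ℂ e) {L : Fin n → F →L[ℂ] F}
    (hL : ∀ i α, L i (e α) = e (FreeMonoid.of i * α)) (r : ℂ) (a : Word n → ℂ) (k : ℕ) (α : Word n) :
    inner ℂ (e 1) (truncSum a (fun i => r • L i) (k+1) (e α)) = 0 := by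
  classical
  unfold truncSum
  rw [_root_.sum_apply, inner_sum]
  refine Finset.sum_eq_zero fun f _ => ?_
  simp only [_root_.smul_apply, wordProd_rL hL, inner_smul_right,
    orthonormal_iff_ite.mp he]
  have : (1 : Word n) ≠ word f * α := by
    intro h
    have := congrArg wordLen h
    rw [wordLen_mul, wordLen_word, wordLen_one] at this
    omega
  simp [this]

lemma inner_truncSumAdj (b : Word n → ℂ) (X : Fin n → F →L[ℂ] F) (k : ℕ) (x y : F) :
    inner ℂ x (truncSumAdj b X k y) = star (inner ℂ y (truncSum (fun α => star (b α)) X k x)) := by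
  rw [truncSumAdj_eq, adjoint_inner_right]; simp

lemma coef_phOp {e : Word n → F} (he : Orthonormal ℂ e) {L : Fin n → F →L[ℂ] F}
    (hL : ∀ i α, L i (e α) = e (FreeMonoid.of i * α)) (r : ℝ) {a b : Word n → ℂ}
    (hs : Summable fun k => truncSum a (fun i => (r:ℂ) • L i) k)
    (hs' : Summable fun k => truncSumAdj b (fun i => (r:ℂ) • L i) k) (α : Word n) :
    inner ℂ (e α) (phOp a b (fun i => (r:ℂ) • L i) (e 1)) = (r:ℂ) ^ wordLen α * a α ∧
    (1 ≤ wordLen α →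
      inner ℂ (e 1) (phOp a b (fun i => (r:ℂ) • L i) (e α)) = (r:ℂ) ^ wordLen α * b α) := by
  classical
  rw [inner_phOp hs hs', inner_phOp hs hs']
  simp only [inner_truncSumAdj, coef_trunc he hL, coef_trunc' he hL, orthonormal_iff_ite.mp he]
  refine ⟨?_, fun h1 => ?_⟩
  · rcases Nat.eq_zero_or_pos (wordLen α) with h | h
    · have := wordLen_eq_zero h
      subst this
      simp
    · obtain ⟨m, hm⟩ : ∃ m, wordLen α = m + 1 := ⟨wordLen α - 1, by omega⟩
      have : α ≠ 1 := by rintro rfl; simp at h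
      rw [hm, tsum_eq_single m (by intro k hk; simp [hk.symm])]
      simp [this]
  · obtain ⟨m, hm⟩ : ∃ m, wordLen α = m + 1 := ⟨wordLen α - 1, by omega⟩
    have : (1 : Word n) ≠ α := by rintro rfl; simp at h1
    rw [hm, tsum_eq_single m (by intro k hk; simp [hk.symm])]
    simp [this]

lemma inBall_rL {L : Fin n → F →L[ℂ] F} (hL : isoFam L) {r : ℝ} (h0 : 0 ≤ r) (h1 : r < 1) :
    inBall 1 (fun i => (r:ℂ) • L i) := by
  unfold inBall
  have h2 : ∑ i, ((r:ℂ) • L i) * adjoint ((r:ℂ) • L i) = ((r:ℂ)^2) • ∑ i, L i * adjoint (L i) := by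
    rw [Finset.smul_sum]
    refine Finset.sum_congr rfl fun i _ => ?_
    rw [← ContinuousLinearMap.star_eq_adjoint, star_smul, smul_mul_smul_comm]
    simp [sq, ContinuousLinearMap.star_eq_adjoint]
  have h3 : ‖∑ i, L i * adjoint (L i)‖ ≤ 1 := by
    refine ContinuousLinearMap.opNorm_le_bound _ zero_le_one fun z => ?_
    have h4 := row_sum zero_le_one le_rfl (isoFam_row hL) (fun i => adjoint (L i) z)
    have h5 := isoFam_row hL z
    rw [_root_.sum_apply]
    simp only [clm_mul_apply]
    rw [one_mul]
    refine abs_le_of_sq_le_sq' ?_ (norm_nonneg _) |>.2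
    linarith
  rw [h2, norm_smul, norm_pow, Complex.norm_real, Real.norm_of_nonneg h0]
  nlinarith [norm_nonneg (∑ i, L i * adjoint (L i))]

lemma exists_sqrt_unit {U : F →L[ℂ] F} (hU : U.IsPositive) {ε : ℝ} (hε : 0 < ε) :
    ∃ W : (F →L[ℂ] F)ˣ, star (W : F →L[ℂ] F) = W ∧
      (W : F →L[ℂ] F) * W = U + (ε:ℂ) • (1 : F →L[ℂ] F) := by
  set U' := U + (ε:ℂ) • (1 : F →L[ℂ] F) with hU'
  have hUn : 0 ≤ U := (ContinuousLinearMap.nonneg_iff_isPositive U).mpr hU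
  have h1 : algebraMap ℝ (F →L[ℂ] F) ε ≤ U' := by
    rw [hU']
    have : algebraMap ℝ (F →L[ℂ] F) ε = (ε:ℂ) • (1 : F →L[ℂ] F) := by
      rw [Algebra.algebraMap_eq_smul_one]; simp
    rw [this]; exact le_add_of_nonneg_left hUn
  have hsp : IsStrictlyPositive U' :=
    (isStrictlyPositive_algebraMap hε).of_le h1
  have hu : IsUnit (CFC.sqrt U') := CFC.isUnit_sqrt_iff_isStrictlyPositive.mpr hsp
  obtain ⟨W, hW⟩ := hu
  refine ⟨W, ?_, ?_⟩
  · rw [hW]; exact (CFC.sqrt_nonneg U').isSelfAdjoint.star_eq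
  · rw [hW]; exact CFC.sqrt_mul_sqrt_self U' hsp.nonneg

open Classical in
lemma key3 (e : HilbertBasis (Word n) ℂ F) {R : Fin n → F →L[ℂ] F}
    (hR : ∀ (i : Fin n) (α : Word n), R i (e α) = e (α * FreeMonoid.of i))
    {a b : Word n → ℂ} (ha : radCond 1 a) (hb : radCond 1 b) (hp : posPH 1 a b)
    {r : ℝ} (h0 : 0 ≤ r) (h1 : r < 1) {ε : ℝ} (hε : 0 < ε) (N : ℕ) :
    ∃ φ : (F →L[ℂ] F) →ₗ[ℂ] ℂ, (∀ T : F →L[ℂ] F, T.IsPositive → 0 ≤ φ T) ∧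
      (∀ α, φ (adjoint (wordProd R (revWord α))) = (N : ℂ)⁻¹ * ((N - wordLen α : ℕ) : ℂ) *
        ((r:ℂ) ^ wordLen α * a α + if α = 1 then (ε:ℂ) else 0)) ∧
      (∀ α, 1 ≤ wordLen α → φ (wordProd R (revWord α)) = (N : ℂ)⁻¹ * ((N - wordLen α : ℕ) : ℂ) *
        ((r:ℂ) ^ wordLen α * b α)) := by
  classical
  obtain ⟨L, hL⟩ := exists_L e
  have isoR : isoFam R := isoFam_shift e (fun i α => α * FreeMonoid.of i)
    (fun i j α β => snoc_inj i j α β) R hR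
  have isoL : isoFam L := isoFam_shift e (fun i α => FreeMonoid.of i * α)
    (fun i j α β => cons_inj i j α β) L hL
  set X : Fin n → F →L[ℂ] F := fun i => (r:ℂ) • L i with hX
  have hXb : inBall 1 X := inBall_rL isoL h0 h1
  obtain ⟨ρ, hρ0, hρ1, hρ⟩ := inBall_rowC hXb
  have hs := summable_truncSum ha hρ0 hρ1 hρ
  have hs' := summable_truncSumAdj hb hρ0 hρ1 hρ
  have hcomm : ∀ i j, X i * R j = R j * X i := by
    intro i j
    refine clm_ext e fun α => ?_
    simp only [hX, clm_mul_apply, _root_.smul_apply, map_smul, hR, hL, mul_assoc]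
  have hUpos := hp F X hXb
  obtain ⟨W, hW1, hW2⟩ := exists_sqrt_unit hUpos hε
  set U' := phOp a b X + (ε:ℂ) • (1 : F →L[ℂ] F) with hU'
  have htoep : toep R U' := toep_add (toep_phOp isoR hcomm hs hs') (toep_smul _ (toep_one isoR))
  set V : Fin n → F →L[ℂ] F := fun i => W * R i * (↑W⁻¹ : F →L[ℂ] F) with hV
  have hWinv : star (↑W⁻¹ : F →L[ℂ] F) = ↑W⁻¹ := by
    have h : star W = W := Units.ext hW1
    rw [← Units.coe_star, star_inv, h]
  have isoV : isoFam V := by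
    intro i j
    simp only [hV]
    rw [← ContinuousLinearMap.star_eq_adjoint, star_mul, star_mul, hWinv, hW1,
      ContinuousLinearMap.star_eq_adjoint]
    calc _ = (↑W⁻¹ : F →L[ℂ] F) * (adjoint (R i) * (W * W) * R j) * ↑W⁻¹ := by
          simp only [mul_assoc]
      _ = _ := by
        rw [hW2, htoep i j]
        split_ifs
        · rw [← hW2]; simp
        · simp
  have hwV : ∀ α, wordProd V α = W * wordProd R α * (↑W⁻¹ : F →L[ℂ] F) := by
    intro α
    induction α using FreeMonoid.inductionOn' with
    | one => simp
    | of_mul i α ih =>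
      rw [wordProd_mul, wordProd_mul, wordProd_of, wordProd_of, ih]
      simp [hV, mul_assoc]
  set h : F := (W : F →L[ℂ] F) (e 1) with hh
  have hval : ∀ α, inner ℂ h (wordProd V (revWord α) h) = inner ℂ (e 1) (U' (e α)) := by
    intro α
    have : wordProd V (revWord α) h = (W : F →L[ℂ] F) (e α) := by
      rw [hwV, hh]
      have : (W * wordProd R (revWord α) * (↑W⁻¹ : F →L[ℂ] F)) ((W : F →L[ℂ] F) (e 1))
        = (W * wordProd R (revWord α) * ((↑W⁻¹ : F →L[ℂ] F) * W)) (e 1) := rfl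
      rw [this, Units.inv_mul, mul_one, clm_mul_apply, R_e hR, one_mul]
    rw [this, hh, ← hW2, clm_mul_apply]
    conv_rhs => rw [← hW1, ContinuousLinearMap.star_eq_adjoint, adjoint_inner_right]
    rw [← ContinuousLinearMap.star_eq_adjoint, hW1]
  have hc := fun α => coef_phOp e.orthonormal hL r hs hs' α
  have hUstar : star U' = U' := by rw [← hW2, star_mul, hW1]
  refine ⟨fej e V h N, fun T hT => fej_pos _ _ _ _ _ hT, fun α => ?_, fun α hα => ?_⟩
  · rw [fej_adjoint, fej_R e.orthonormal hR isoV, hval]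
    have h3 : star (inner ℂ (e 1) (U' (e α))) = inner ℂ (e α) (U' (e 1)) := by
      conv_rhs => rw [← hUstar, ContinuousLinearMap.star_eq_adjoint, adjoint_inner_right]
      simp
    rw [star_mul', star_mul', h3, hU', _root_.add_apply, inner_add_right, (hc α).1]
    simp [inner_smul_right, orthonormal_iff_ite.mp e.orthonormal]
  · rw [fej_R e.orthonormal hR isoV, hval, hU', _root_.add_apply, inner_add_right, (hc α).2 hα]
    have : (1 : Word n) ≠ α := by rintro rfl; simp at hα
    simp [inner_smul_right, orthonormal_iff_ite.mp e.orthonormal, this]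

end toep

section fun1
variable {n : ℕ} {F : Type} [NormedAddCommGroup F] [InnerProductSpace ℂ F] [CompleteSpace F]

lemma opSys_adjoint {R : Fin n → F →L[ℂ] F} {T : F →L[ℂ] F} (hT : T ∈ opSys R) :
    adjoint T ∈ opSys R := by
  have h1 : ∀ S ∈ Submodule.span ℂ
    ((Set.range fun α : Word n => wordProd R α) ∪
      (Set.range fun α : Word n => adjoint (wordProd R α))), adjoint S ∈ opSys R := by
    intro S hS
    induction hS using Submodule.span_induction with
    | mem x hx =>
      rcases hx with ⟨α, rfl⟩ | ⟨α, rfl⟩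
      · exact (elRadj R α).2
      · rw [adjoint_adjoint]; exact (elR R α).2
    | zero => simp
    | add x y _ _ hx hy => rw [map_add]; exact add_mem hx hy
    | smul c x _ hx => rw [map_smulₛₗ]; exact Submodule.smul_mem _ _ hx
  have hc : IsClosed {S : F →L[ℂ] F | adjoint S ∈ opSys R} :=
    (Submodule.isClosed_topologicalClosure _).preimage (adjoint : (F →L[ℂ] F) ≃ₗᵢ⋆[ℂ] (F →L[ℂ] F)).continuous
  exact closure_minimal h1 hc hT

lemma elR_one (R : Fin n → F →L[ℂ] F) : ((elR R 1 : opSys R) : F →L[ℂ] F) = 1 := by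
  simp [elR, wordProd_one]

lemma posBound_sa {R : Fin n → F →L[ℂ] F} {μ : ↥(opSys R) →ₗ[ℂ] ℂ} (hμ : posFun R μ)
    (T : opSys R) (hT : IsSelfAdjoint (T : F →L[ℂ] F)) :
    ‖μ T‖ ≤ ‖μ (elR R 1)‖ * ‖T‖ := by
  have h1 := IsSelfAdjoint.le_algebraMap_norm_self hT
  have h2 := IsSelfAdjoint.neg_algebraMap_norm_le_self hT
  have hal : algebraMap ℝ (F →L[ℂ] F) ‖(T : F →L[ℂ] F)‖ = ((‖T‖:ℂ) • elR R 1 : opSys R) := by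
    rw [Algebra.algebraMap_eq_smul_one, Submodule.coe_smul, elR_one]; simp
  rw [hal, ContinuousLinearMap.le_def] at h1 h2
  have h3 := hμ ((‖T‖:ℂ) • elR R 1 - T) (by simpa using h1)
  have h4 := hμ (T - - ((‖T‖:ℂ) • elR R 1)) (by simpa using h2)
  have h5 := hμ (elR R 1) (by rw [elR_one]; exact ContinuousLinearMap.isPositive_one)
  simp only [map_sub, map_neg, map_smul] at h3 h4
  rw [Complex.le_def] at h3 h4 h5
  simp at h3 h4 h5
  have e1 : ‖μ (elR R 1)‖ = (μ (elR R 1)).re := by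
    rw [Complex.norm_def, Complex.normSq_apply, ← h5.2]
    simp [h5.1]
  have him : (μ T).im = 0 := by
    have := h4.2; rw [← h5.2] at this; simpa using this.symm
  have e2 : ‖μ T‖ = |(μ T).re| := by
    rw [Complex.norm_def, Complex.normSq_apply, him]
    simp [Real.sqrt_mul_self_eq_abs]
  rw [e1, e2, abs_le]
  constructor <;> simp only [Submodule.coe_norm] at * <;> nlinarith [h3.1, h4.1]

lemma posBound {R : Fin n → F →L[ℂ] F} {μ : ↥(opSys R) →ₗ[ℂ] ℂ} (hμ : posFun R μ)
    (T : opSys R) : ‖μ T‖ ≤ (2 * ‖μ (elR R 1)‖) * ‖T‖ := by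
  set T' : opSys R := ⟨adjoint (T : F →L[ℂ] F), opSys_adjoint T.2⟩ with hT'
  have hn : ‖T'‖ = ‖T‖ := by
    rw [hT', Submodule.coe_norm, Submodule.coe_norm]
    exact LinearIsometryEquiv.norm_map _ _
  have hA := posBound_sa hμ (T + T') (by
    rw [isSelfAdjoint_iff, ContinuousLinearMap.star_eq_adjoint]; simp [hT', add_comm])
  have hB := posBound_sa hμ (Complex.I • T + (-Complex.I) • T') (by
    rw [isSelfAdjoint_iff, ContinuousLinearMap.star_eq_adjoint]; simp [hT', map_smulₛₗ, add_comm])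
  have hAn : ‖T + T'‖ ≤ 2 * ‖T‖ := (norm_add_le _ _).trans (by rw [hn]; linarith)
  have hBn : ‖Complex.I • T + (-Complex.I) • T'‖ ≤ 2 * ‖T‖ :=
    (norm_add_le _ _).trans (by rw [norm_smul, norm_smul, hn]; simp; linarith)
  have hT : μ T = (1/2 : ℂ) * μ (T + T') + (- Complex.I / 2) * μ (Complex.I • T + (-Complex.I) • T') := by
    simp only [map_add, map_smul, smul_eq_mul]
    linear_combination ((μ T)/2 - μ T' / 2) * Complex.I_sq
  rw [hT]
  have hM := norm_nonneg (μ (elR R 1))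
  refine (norm_add_le _ _).trans ?_
  rw [norm_mul, norm_mul]
  simp only [norm_div, norm_neg, Complex.norm_I, norm_one, RCLike.norm_ofNat]
  nlinarith [mul_le_mul_of_nonneg_left hAn hM, mul_le_mul_of_nonneg_left hBn hM]

lemma posCont {R : Fin n → F →L[ℂ] F} {μ : ↥(opSys R) →ₗ[ℂ] ℂ} (hμ : posFun R μ) :
    Continuous μ := AddMonoidHomClass.continuous_of_bound μ _ (posBound hμ)

lemma part2 {R : Fin n → F →L[ℂ] F} {μ ν : ↥(opSys R) →ₗ[ℂ] ℂ} (hμ : posFun R μ) (hν : posFun R ν)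
    (ha : ∀ α : Word n, aCoeff R μ α = aCoeff R ν α)
    (hb : ∀ α : Word n, 1 ≤ wordLen α → bCoeff R μ α = bCoeff R ν α) : μ = ν := by
  have hadj : ∀ α, μ (elRadj R α) = ν (elRadj R α) := fun α => by
    have := ha (revWord α); simpa [aCoeff, rev_rev] using this
  have hR : ∀ α, μ (elR R α) = ν (elR R α) := fun α => by
    rcases Nat.eq_zero_or_pos (wordLen α) with h | h
    · have := wordLen_eq_zero h
      subst this
      have h1 : elR R 1 = elRadj R 1 := by
        apply Subtype.ext
        simp only [elR, elRadj, wordProd_one]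
        exact (star_one (F →L[ℂ] F)).symm
      rw [h1]; exact hadj 1
    · have := hb (revWord α) (by rw [wordLen_rev]; exact h); simpa [bCoeff, rev_rev] using this
  have h1 : ∀ S (hS : S ∈ Submodule.span ℂ
    ((Set.range fun α : Word n => wordProd R α) ∪
      (Set.range fun α : Word n => adjoint (wordProd R α)))),
      μ ⟨S, Submodule.le_topologicalClosure _ hS⟩ = ν ⟨S, Submodule.le_topologicalClosure _ hS⟩ := by
    intro S hS
    induction hS using Submodule.span_induction with
    | mem x hx =>
      rcases hx with ⟨α, rfl⟩ | ⟨α, rfl⟩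
      · exact hR α
      · exact hadj α
    | zero => exact (map_zero μ).trans (map_zero ν).symm
    | add x y hx hy hx' hy' =>
      have := congrArg₂ (· + ·) hx' hy'
      simp only [← map_add] at this
      exact this
    | smul c x hx hx' =>
      have := congrArg (c • ·) hx'
      simp only [← map_smul] at this
      exact this
  ext T
  have hcl : (T : F →L[ℂ] F) ∈ closure (Submodule.span ℂ
    ((Set.range fun α : Word n => wordProd R α) ∪
      (Set.range fun α : Word n => adjoint (wordProd R α))) : Set (F →L[ℂ] F)) := T.2
  obtain ⟨x, hx, hlim⟩ := mem_closure_iff_seq_limit.mp hcl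
  have hlim' : Tendsto (fun k => (⟨x k, Submodule.le_topologicalClosure _ (hx k)⟩ : opSys R))
      atTop (nhds T) := tendsto_subtype_rng.mpr hlim
  refine tendsto_nhds_unique (((posCont hμ).tendsto T).comp hlim') ?_
  refine (((posCont hν).tendsto T).comp hlim').congr fun k => ?_
  exact (h1 _ (hx k)).symm

lemma part3 (e : HilbertBasis (Word n) ℂ F) {R : Fin n → F →L[ℂ] F}
    (hR : ∀ (i : Fin n) (α : Word n), R i (e α) = e (α * FreeMonoid.of i))
    {a b : Word n → ℂ} (ha : radCond 1 a) (hb : radCond 1 b) (hp : posPH 1 a b) :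
    ∃ μ : ↥(opSys R) →ₗ[ℂ] ℂ, posFun R μ ∧
        (∀ α : Word n, a α = aCoeff R μ α) ∧
        (∀ α : Word n, 1 ≤ wordLen α → b α = bCoeff R μ α) := by
  classical
  set r : ℕ → ℝ := fun j => 1 - 1 / ((j:ℝ) + 1) with hr
  set ε : ℕ → ℝ := fun j => 1 / ((j:ℝ) + 1) with hε
  have hε0 : ∀ j, 0 < ε j := fun j => by positivity
  have hε1 : ∀ j, ε j ≤ 1 := fun j => by
    simp only [hε]; rw [div_le_one (by positivity)]; linarith [(Nat.cast_nonneg j : (0:ℝ) ≤ j)]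
  have hεt : Tendsto ε atTop (nhds 0) := tendsto_one_div_add_atTop_nhds_zero_nat
  have hrt : Tendsto r atTop (nhds 1) := by simpa using hεt.const_sub 1
  have key := fun j => key3 e hR ha hb hp (r := r j) (by simp only [hr]; linarith [hε1 j])
    (by simp only [hr]; linarith [hε0 j]) (hε0 j) (j+1)
  choose φ hφ1 hφ2 hφ3 using key
  set ψ : ℕ → (opSys R →ₗ[ℂ] ℂ) := fun j => (φ j).comp (opSys R).subtype with hψ
  have hψp : ∀ j, posFun R (ψ j) := fun j T hT => hφ1 j T hT
  have hone : ∀ j, ‖ψ j (elR R 1)‖ ≤ ‖a 1‖ + 1 := by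
    intro j
    have h := hφ2 j 1
    have h1 : adjoint (wordProd R (revWord 1)) = ((elR R 1 : opSys R) : F →L[ℂ] F) := by
      rw [rev_one, wordProd_one, elR_one]; exact star_one (F →L[ℂ] F)
    rw [h1] at h
    have h2 : ψ j (elR R 1) = a 1 + ε j := by
      simp only [hψ, LinearMap.comp_apply, Submodule.subtype_apply, h]
      have : ((j+1:ℕ):ℂ) ≠ 0 := by exact_mod_cast Nat.succ_ne_zero j
      simp only [wordLen_one, Nat.sub_zero, inv_mul_cancel₀ this]
      simp
    rw [h2]
    refine (norm_add_le _ _).trans ?_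
    have := hε1 j
    have h0 := (hε0 j).le
    simp [abs_of_nonneg h0]; exact this
  have hbd : ∀ j T, ‖ψ j T‖ ≤ 2 * (‖a 1‖ + 1) * ‖T‖ := fun j T =>
    (posBound (hψp j) T).trans (by gcongr; exact hone j)
  have hlim : ∀ T : opSys R, ∃ z : ℂ, Tendsto (fun j => ψ j T) (hyperfilter ℕ : Filter ℕ) (nhds z) := by
    intro T
    obtain ⟨z, _, hz⟩ := (isCompact_closedBall (0:ℂ) (2 * (‖a 1‖ + 1) * ‖T‖)).ultrafilter_le_nhds
      ((hyperfilter ℕ).map (fun j => ψ j T)) (by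
        rw [Filter.le_principal_iff]
        refine Filter.mem_map.mpr (Filter.univ_mem' fun j => ?_)
        simpa using hbd j T)
    exact ⟨z, hz⟩
  choose m hm using hlim
  let μ : opSys R →ₗ[ℂ] ℂ :=
    { toFun := m
      map_add' := fun S T => tendsto_nhds_unique (hm (S + T))
        (((hm S).add (hm T)).congr fun j => (map_add _ _ _).symm)
      map_smul' := fun c T => tendsto_nhds_unique (hm (c • T))
        (((hm T).const_smul c).congr fun j => (map_smul _ _ _).symm) }
  have hval : ∀ T z, Tendsto (fun j => ψ j T) atTop (nhds z) → z = μ T := fun T z h =>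
    tendsto_nhds_unique (h.mono_left Nat.hyperfilter_le_atTop) (hm T)
  have hN : ∀ l : ℕ, Tendsto (fun j : ℕ => (((j+1:ℕ):ℂ))⁻¹ * (((j+1) - l : ℕ) : ℂ)) atTop (nhds 1) := by
    intro l
    have h1 : Tendsto (fun j : ℕ => (1:ℂ) - ((l:ℂ) * (ε j:ℂ))) atTop (nhds 1) := by
      have : Tendsto (fun j : ℕ => (ε j : ℂ)) atTop (nhds ((0:ℝ):ℂ)) :=
        (Complex.continuous_ofReal.tendsto 0).comp hεt
      simpa using (this.const_mul (l:ℂ)).const_sub 1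
    refine h1.congr' ?_
    filter_upwards [eventually_ge_atTop l] with j hj
    have : ((j:ℂ)+1) ≠ 0 := by exact_mod_cast Nat.succ_ne_zero j
    rw [Nat.cast_sub (by omega)]
    simp only [hε]; push_cast
    field_simp
  have hrl : ∀ l : ℕ, Tendsto (fun j : ℕ => (r j : ℂ) ^ l) atTop (nhds 1) := by
    intro l
    have : Tendsto (fun j : ℕ => (r j : ℂ)) atTop (nhds ((1:ℝ):ℂ)) :=
      (Complex.continuous_ofReal.tendsto 1).comp hrt
    simpa using this.pow l
  have hεc : Tendsto (fun j : ℕ => (ε j : ℂ)) atTop (nhds 0) := by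
    have : Tendsto (fun j : ℕ => (ε j : ℂ)) atTop (nhds ((0:ℝ):ℂ)) :=
        (Complex.continuous_ofReal.tendsto 0).comp hεt
    simpa using this
  refine ⟨μ, ?_, ?_, ?_⟩
  · intro T hT
    exact ge_of_tendsto' (hm T) fun j => hψp j T hT
  · intro α
    refine hval _ _ ?_
    have : Tendsto (fun j : ℕ => (((j+1:ℕ):ℂ))⁻¹ * (((j+1) - wordLen α : ℕ) : ℂ) *
        ((r j:ℂ) ^ wordLen α * a α + if α = 1 then (ε j:ℂ) else 0)) atTop
        (nhds (1 * (1 * a α + 0))) := by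
      refine (hN _).mul (((hrl _).mul_const _).add ?_)
      split_ifs
      · exact hεc
      · exact tendsto_const_nhds
    rw [one_mul, one_mul, add_zero] at this
    exact this.congr fun j => (hφ2 j α).symm
  · intro α hα
    refine hval _ _ ?_
    have : Tendsto (fun j : ℕ => (((j+1:ℕ):ℂ))⁻¹ * (((j+1) - wordLen α : ℕ) : ℂ) *
        ((r j:ℂ) ^ wordLen α * b α)) atTop
        (nhds (1 * (1 * b α))) := (hN _).mul ((hrl _).mul_const _)
    rw [one_mul, one_mul] at this
    exact this.congr fun j => (hφ3 j α hα).symm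

end fun1

section part1a
variable {n : ℕ} {K : Type} [NormedAddCommGroup K] [InnerProductSpace ℂ K] [CompleteSpace K]

lemma core {X : Fin n → K →L[ℂ] K} {ρ : ℝ} (h0 : 0 ≤ ρ) (h1 : ρ ≤ 1) (hX : rowC ρ X) (ξ : K)
    (c : Word n → ℂ) (N : ℕ) (hc : ∀ β, N ≤ wordLen β → c β = 0) :
    0 ≤ ∑ β ∈ wB n N, (2 * (inner ℂ (c β • ξ) (∑ α ∈ wB n N, c (β * α) • wordProd X α ξ)).re
      - ‖c β • ξ‖ ^ 2) := by
  set k : Word n → K := fun β => ∑ α ∈ wB n N, c (β * α) • wordProd X α ξ with hk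
  have hk0 : ∀ β, N ≤ wordLen β → k β = 0 := by
    intro β hβ
    refine Finset.sum_eq_zero fun α _ => ?_
    rw [hc _ (by rw [wordLen_mul]; omega), zero_smul]
  have hrec : ∀ β, k β - c β • ξ = ∑ i, X i (k (β * FreeMonoid.of i)) := by
    intro β
    have h2 : k β = ∑ α ∈ wB n (N+1), c (β * α) • wordProd X α ξ := by
      rw [sum_wB_mono (Nat.le_succ N)]
      intro α hα
      rw [hc _ (by rw [wordLen_mul]; omega), zero_smul]
    rw [h2, sum_wB_cons, mul_one, wordProd_one, one_apply_eq_self, add_sub_cancel_right,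
      Finset.sum_comm]
    refine Finset.sum_congr rfl fun i _ => ?_
    simp only [hk, map_sum, map_smul]
    refine Finset.sum_congr rfl fun α _ => ?_
    rw [wordProd_mul, wordProd_of, clm_mul_apply, mul_assoc]
  have hterm : ∀ β, 2 * (inner ℂ (c β • ξ) (k β)).re - ‖c β • ξ‖ ^ 2
      = ‖k β‖ ^ 2 - ‖∑ i, X i (k (β * FreeMonoid.of i))‖ ^ 2 := by
    intro β
    rw [← hrec, norm_sub_rev, norm_sub_sq (𝕜 := ℂ)]
    simp only [RCLike.re_eq_complex_re]; ring
  have hle : ∑ β ∈ wB n N, ‖∑ i, X i (k (β * FreeMonoid.of i))‖ ^ 2 ≤ ∑ β ∈ wB n N, ‖k β‖ ^ 2 := by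
    calc _ ≤ ∑ β ∈ wB n N, ∑ i, ‖k (β * FreeMonoid.of i)‖ ^ 2 :=
          Finset.sum_le_sum fun β _ => row_sum h0 h1 hX _
      _ ≤ ∑ β ∈ wB n N, ∑ i, ‖k (β * FreeMonoid.of i)‖ ^ 2 + ‖k 1‖ ^ 2 :=
          le_add_of_nonneg_right (by positivity)
      _ = ∑ β ∈ wB n (N+1), ‖k β‖ ^ 2 := (sum_wB_snoc N (fun β => ‖k β‖ ^ 2)).symm
      _ = _ := sum_wB_mono (Nat.le_succ N) _ (fun β hβ => by rw [hk0 β hβ]; simp)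
  calc (0:ℝ) ≤ ∑ β ∈ wB n N, ‖k β‖ ^ 2 - ∑ β ∈ wB n N, ‖∑ i, X i (k (β * FreeMonoid.of i))‖ ^ 2 :=
        sub_nonneg.mpr hle
    _ = _ := by rw [← Finset.sum_sub_distrib]; exact Finset.sum_congr rfl fun β _ => (hterm β).symm

lemma norm_coef {X : Fin n → K →L[ℂ] K} {ρ : ℝ} (h0 : 0 ≤ ρ) (hX : rowC ρ X) (ξ : K) (k : ℕ) :
    √(∑ f : Fin k → Fin n, ‖inner ℂ ξ (wordProd X (word f) ξ)‖ ^ 2) ≤ ‖ξ‖ ^ 2 * ρ ^ k := by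
  apply Real.sqrt_le_iff.mpr
  refine ⟨by positivity, ?_⟩
  calc _ ≤ ∑ f : Fin k → Fin n, ‖adjoint (wordProd X (word f)) ξ‖ ^ 2 * ‖ξ‖ ^ 2 := by
        refine Finset.sum_le_sum fun f _ => ?_
        rw [← adjoint_inner_left, ← mul_pow]
        gcongr
        exact norm_inner_le_norm _ _
    _ = (∑ f : Fin k → Fin n, ‖adjoint (wordProd X (word f)) ξ‖ ^ 2) * ‖ξ‖ ^ 2 := by
        rw [Finset.sum_mul]
    _ ≤ ((ρ ^ k) ^ 2 * ‖ξ‖ ^ 2) * ‖ξ‖ ^ 2 := by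
        gcongr; exact level_row hX k ξ
    _ = _ := by ring

end part1a

section part1b
variable {n : ℕ} {F : Type} [NormedAddCommGroup F] [InnerProductSpace ℂ F] [CompleteSpace F]

/-- level-`k` piece of the operator kernel, adjoint side -/
def tA (R : Fin n → F →L[ℂ] F) (c : Word n → ℂ) (k : ℕ) : opSys R :=
  ∑ f : Fin k → Fin n, c (word f) • elRadj R (revWord (word f))

/-- level-`k` piece of the operator kernel, analytic side -/
def tB (R : Fin n → F →L[ℂ] F) (c : Word n → ℂ) (k : ℕ) : opSys R :=
  ∑ f : Fin k → Fin n, c (word f) • elR R (revWord (word f))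

lemma tA_coe (R : Fin n → F →L[ℂ] F) (c : Word n → ℂ) (k : ℕ) :
    ((tA R c k : opSys R) : F →L[ℂ] F) =
      ∑ f : Fin k → Fin n, c (word f) • adjoint (wordProd R (revWord (word f))) := by
  simp [tA, elRadj]

lemma tB_coe (R : Fin n → F →L[ℂ] F) (c : Word n → ℂ) (k : ℕ) :
    ((tB R c k : opSys R) : F →L[ℂ] F) =
      ∑ f : Fin k → Fin n, c (word f) • wordProd R (revWord (word f)) := by
  simp [tB, elR]

lemma tA_norm {R : Fin n → F →L[ℂ] F} (isoR : isoFam R) (c : Word n → ℂ) (k : ℕ) :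
    ‖tA R c k‖ ≤ √(∑ f : Fin k → Fin n, ‖c (word f)‖ ^ 2) := by
  rw [Submodule.coe_norm, tA_coe]
  have h := norm_truncSumAdj_le zero_le_one (isoFam_row isoR) (fun α => c (revWord α)) k
  rw [one_pow, mul_one, sum_level_rev k (fun α => ‖c α‖ ^ 2)] at h
  refine le_trans (le_of_eq ?_) h
  rw [truncSumAdj, ← sum_level_rev k (fun α => c (revWord α) • adjoint (wordProd R α))]
  simp only [rev_rev]

lemma tB_norm {R : Fin n → F →L[ℂ] F} (isoR : isoFam R) (c : Word n → ℂ) (k : ℕ) :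
    ‖tB R c k‖ ≤ √(∑ f : Fin k → Fin n, ‖c (word f)‖ ^ 2) := by
  rw [Submodule.coe_norm, tB_coe]
  have h := norm_truncSum_le zero_le_one (isoFam_row isoR) (fun α => c (revWord α)) k
  rw [one_pow, mul_one, sum_level_rev k (fun α => ‖c α‖ ^ 2)] at h
  refine le_trans (le_of_eq ?_) h
  rw [truncSum, ← sum_level_rev k (fun α => c (revWord α) • wordProd R α)]
  simp only [rev_rev]

lemma tB_adj (R : Fin n → F →L[ℂ] F) (c : Word n → ℂ) (k : ℕ) :
    ((tB R (fun α => star (c α)) k : opSys R) : F →L[ℂ] F) = adjoint (tA R c k : F →L[ℂ] F) := by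
  rw [tA_coe, tB_coe, map_sum]
  refine Finset.sum_congr rfl fun f _ => ?_
  rw [map_smulₛₗ, adjoint_adjoint]; rfl

lemma sq_bound {S M : ℝ} (hS : 0 ≤ S) (h : S ≤ M * √S) : S ≤ M ^ 2 := by
  have h1 := Real.sq_sqrt hS
  have h2 := Real.sqrt_nonneg S
  rcases h2.eq_or_lt with h3 | h3
  · rw [← h3] at h1; nlinarith [sq_nonneg M]
  · have : √S ≤ M := by
      by_contra hc
      push Not at hc
      nlinarith
    nlinarith

lemma rad_a {R : Fin n → F →L[ℂ] F} (isoR : isoFam R) {μ : ↥(opSys R) →ₗ[ℂ] ℂ}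
    (hμ : posFun R μ) : radCond 1 (aCoeff R μ) := by
  refine radCond_of_bound (C := (2 * ‖μ (elR R 1)‖) ^ 2) fun k => ?_
  refine sq_bound (by positivity) ?_
  have h1 : μ (tA R (fun α => star (aCoeff R μ α)) k) =
      ((∑ f : Fin k → Fin n, ‖aCoeff R μ (word f)‖ ^ 2 : ℝ) : ℂ) := by
    simp only [tA, map_sum, map_smul, smul_eq_mul]
    push_cast
    refine Finset.sum_congr rfl fun f _ => ?_
    exact Complex.conj_mul' _
  have h2 := (posBound hμ (tA R (fun α => star (aCoeff R μ α)) k)).trans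
    (mul_le_mul_of_nonneg_left (tA_norm isoR _ k) (by positivity))
  rw [h1, Complex.norm_real, Real.norm_of_nonneg (by positivity)] at h2
  simpa only [norm_star] using h2

lemma rad_b {R : Fin n → F →L[ℂ] F} (isoR : isoFam R) {μ : ↥(opSys R) →ₗ[ℂ] ℂ}
    (hμ : posFun R μ) : radCond 1 (bCoeff R μ) := by
  refine radCond_of_bound (C := (2 * ‖μ (elR R 1)‖) ^ 2) fun k => ?_
  refine sq_bound (by positivity) ?_
  have h1 : μ (tB R (fun α => star (bCoeff R μ α)) k) =
      ((∑ f : Fin k → Fin n, ‖bCoeff R μ (word f)‖ ^ 2 : ℝ) : ℂ) := by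
    simp only [tB, map_sum, map_smul, smul_eq_mul]
    push_cast
    refine Finset.sum_congr rfl fun f _ => ?_
    exact Complex.conj_mul' _
  have h2 := (posBound hμ (tB R (fun α => star (bCoeff R μ α)) k)).trans
    (mul_le_mul_of_nonneg_left (tB_norm isoR _ k) (by positivity))
  rw [h1, Complex.norm_real, Real.norm_of_nonneg (by positivity)] at h2
  simpa only [norm_star] using h2

lemma fin_core (e : HilbertBasis (Word n) ℂ F) {R : Fin n → F →L[ℂ] F}
    (hR : ∀ (i : Fin n) (α : Word n), R i (e α) = e (α * FreeMonoid.of i))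
    {K : Type} [NormedAddCommGroup K] [InnerProductSpace ℂ K] [CompleteSpace K]
    {X : Fin n → K →L[ℂ] K} {ρ : ℝ} (h0 : 0 ≤ ρ) (h1 : ρ ≤ 1) (hX : rowC ρ X) (ξ : K)
    (hs : Summable fun k => (tA R (fun α => inner ℂ ξ (wordProd X α ξ)) k : F →L[ℂ] F))
    (f : F) (N : ℕ) (hf : ∀ β, N ≤ wordLen β → inner ℂ (e β) f = 0) :
    0 ≤ 2 * (inner ℂ f ((∑' k, (tA R (fun α => inner ℂ ξ (wordProd X α ξ)) k : F →L[ℂ] F)) f)).re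
      - ‖ξ‖ ^ 2 * ‖f‖ ^ 2 := by
  classical
  set c : Word n → ℂ := fun β => inner ℂ (e β) f with hc
  have hfe : f = ∑ β ∈ wB n N, c β • e β := by
    refine vec_ext e fun β => ?_
    rw [inner_sum]
    simp only [inner_smul_right, orthonormal_iff_ite.mp e.orthonormal]
    rw [Finset.sum_eq_single β]
    · simp [hc]
    · intro γ _ hγ; simp [hγ.symm]
    · intro hβ
      have : N ≤ wordLen β := by by_contra h; exact hβ (mem_wB.mpr (by omega))
      simp [hc, hf β this]
  have hexp : ∀ v, inner ℂ f v = ∑ β ∈ wB n N, star (c β) * inner ℂ (e β) v := by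
    intro v
    conv_lhs => rw [hfe]
    rw [sum_inner]
    refine Finset.sum_congr rfl fun β _ => ?_
    rw [inner_smul_left]
    rfl
  have hnorm : ‖f‖ ^ 2 = ∑ β ∈ wB n N, ‖c β‖ ^ 2 := by
    have h2 : inner ℂ f f = ((‖f‖ ^ 2 : ℝ) : ℂ) := by
      rw [inner_self_eq_norm_sq_to_K]; simp
    have : ((‖f‖ ^ 2 : ℝ) : ℂ) = ((∑ β ∈ wB n N, ‖c β‖ ^ 2 : ℝ) : ℂ) := by
      rw [← h2, hexp]
      push_cast
      refine Finset.sum_congr rfl fun β _ => ?_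
      exact Complex.conj_mul' _
    exact_mod_cast this
  have hin : ∀ α, inner ℂ f (adjoint (wordProd R (revWord α)) f)
      = ∑ β ∈ wB n N, star (c β) * c (β * α) := by
    intro α
    rw [hexp]
    refine Finset.sum_congr rfl fun β _ => ?_
    rw [adjoint_inner_right, R_e hR]
  have htA : ∀ k, inner ℂ f ((tA R (fun α => inner ℂ ξ (wordProd X α ξ)) k : F →L[ℂ] F) f)
      = ∑ g : Fin k → Fin n, inner ℂ ξ (wordProd X (word g) ξ) *
        ∑ β ∈ wB n N, star (c β) * c (β * word g) := by
    intro k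
    rw [tA_coe, _root_.sum_apply, inner_sum]
    refine Finset.sum_congr rfl fun g _ => ?_
    rw [_root_.smul_apply, inner_smul_right, hin]
  have hH : inner ℂ f ((∑' k, (tA R (fun α => inner ℂ ξ (wordProd X α ξ)) k : F →L[ℂ] F)) f)
      = ∑ β ∈ wB n N, inner ℂ (c β • ξ) (∑ α ∈ wB n N, c (β * α) • wordProd X α ξ) := by
    rw [← coefL_apply, ContinuousLinearMap.map_tsum _ hs]
    simp only [coefL_apply, htA]
    rw [tsum_eq_sum (s := Finset.range N)]
    · rw [← sum_wB N (fun α => inner ℂ ξ (wordProd X α ξ) * ∑ β ∈ wB n N, star (c β) * c (β * α))]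
      simp only [Finset.mul_sum, inner_sum, inner_smul_left, inner_smul_right]
      rw [Finset.sum_comm]
      refine Finset.sum_congr rfl fun β _ => Finset.sum_congr rfl fun α _ => ?_
      simp only [RCLike.star_def]; ring
    · intro k hk
      refine Finset.sum_eq_zero fun g _ => ?_
      rw [Finset.sum_eq_zero, mul_zero]
      intro β _
      have : c (β * word g) = 0 := hf _ (by
        rw [wordLen_mul, wordLen_word]; simp at hk; omega)
      rw [this, mul_zero]
  have := core h0 h1 hX ξ c N hf
  rw [hH, hnorm, Complex.re_sum, Finset.mul_sum, Finset.mul_sum, ← Finset.sum_sub_distrib]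
  refine this.trans (le_of_eq (Finset.sum_congr rfl fun β _ => ?_))
  rw [norm_smul]; ring

lemma full_core (e : HilbertBasis (Word n) ℂ F) {R : Fin n → F →L[ℂ] F}
    (hR : ∀ (i : Fin n) (α : Word n), R i (e α) = e (α * FreeMonoid.of i))
    {K : Type} [NormedAddCommGroup K] [InnerProductSpace ℂ K] [CompleteSpace K]
    {X : Fin n → K →L[ℂ] K} {ρ : ℝ} (h0 : 0 ≤ ρ) (h1 : ρ ≤ 1) (hX : rowC ρ X) (ξ : K)
    (hs : Summable fun k => (tA R (fun α => inner ℂ ξ (wordProd X α ξ)) k : F →L[ℂ] F)) (f : F) :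
    0 ≤ 2 * (inner ℂ f ((∑' k, (tA R (fun α => inner ℂ ξ (wordProd X α ξ)) k : F →L[ℂ] F)) f)).re
      - ‖ξ‖ ^ 2 * ‖f‖ ^ 2 := by
  classical
  set H := ∑' k, (tA R (fun α => inner ℂ ξ (wordProd X α ξ)) k : F →L[ℂ] F) with hH
  have hcl : IsClosed {f : F | 0 ≤ 2 * (inner ℂ f (H f)).re - ‖ξ‖ ^ 2 * ‖f‖ ^ 2} := by
    refine isClosed_le continuous_const ?_
    have : Continuous fun f : F => (inner ℂ f (H f)) := continuous_id.inner H.continuous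
    have := Complex.continuous_re.comp this
    fun_prop
  have hspan : ∀ f ∈ Submodule.span ℂ (Set.range e), ∃ N, ∀ β, N ≤ wordLen β → inner ℂ (e β) f = 0 := by
    intro f hf
    induction hf using Submodule.span_induction with
    | mem x hx =>
      obtain ⟨γ, rfl⟩ := hx
      refine ⟨wordLen γ + 1, fun β hβ => ?_⟩
      rw [orthonormal_iff_ite.mp e.orthonormal, if_neg]
      rintro rfl; omega
    | zero => exact ⟨0, fun β _ => inner_zero_right _⟩
    | add x y _ _ hx hy =>
      obtain ⟨N, hN⟩ := hx
      obtain ⟨M, hM⟩ := hy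
      refine ⟨max N M, fun β hβ => ?_⟩
      rw [inner_add_right, hN β (by omega), hM β (by omega), add_zero]
    | smul c x _ hx =>
      obtain ⟨N, hN⟩ := hx
      exact ⟨N, fun β hβ => by rw [inner_smul_right, hN β hβ, mul_zero]⟩
  have hmem : f ∈ (Submodule.span ℂ (Set.range e)).topologicalClosure := by
    rw [e.dense_span]; trivial
  refine closure_minimal (fun g hg => ?_) hcl hmem
  obtain ⟨N, hN⟩ := hspan g hg
  exact fin_core e hR h0 h1 hX ξ hs g N hN

lemma cpos {z : ℂ} (h : 0 ≤ z) : ((RCLike.re z : ℝ) : ℂ) = z ∧ 0 ≤ (RCLike.re z : ℝ) := by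
  rw [Complex.le_def] at h
  refine ⟨?_, h.1⟩
  apply Complex.ext
  · simp
  · simpa using h.2

lemma part1 (e : HilbertBasis (Word n) ℂ F) {R : Fin n → F →L[ℂ] F}
    (hR : ∀ (i : Fin n) (α : Word n), R i (e α) = e (α * FreeMonoid.of i))
    {μ : ↥(opSys R) →ₗ[ℂ] ℂ} (hμ : posFun R μ) :
    radCond 1 (aCoeff R μ) ∧ radCond 1 (bCoeff R μ) ∧ posPH 1 (aCoeff R μ) (bCoeff R μ) := by
  have isoR : isoFam R := isoFam_shift e (fun i α => α * FreeMonoid.of i)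
    (fun i j α β => snoc_inj i j α β) R hR
  have ha := rad_a isoR hμ
  have hb := rad_b isoR hμ
  refine ⟨ha, hb, ?_⟩
  intro K _ _ _ X hXb
  obtain ⟨ρ, hρ0, hρ1, hρ⟩ := inBall_rowC hXb
  have hs := summable_truncSum ha hρ0 hρ1 hρ
  have hs' := summable_truncSumAdj hb hρ0 hρ1 hρ
  suffices hmain : ∀ ξ, 0 ≤ inner ℂ ξ (phOp (aCoeff R μ) (bCoeff R μ) X ξ) by
    rw [ContinuousLinearMap.isPositive_iff_complex]
    intro ξ
    have h := hmain ξ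
    rw [← inner_conj_symm, show (starRingEnd ℂ) (inner ℂ ξ (phOp (aCoeff R μ) (bCoeff R μ) X ξ)) =
      inner ℂ ξ (phOp (aCoeff R μ) (bCoeff R μ) X ξ) from
      (IsSelfAdjoint.of_nonneg h).star_eq]
    exact cpos h
  intro ξ
  have : CompleteSpace (opSys R) :=
    (Submodule.isClosed_topologicalClosure _).completeSpace_coe
  set c : Word n → ℂ := fun α => inner ℂ ξ (wordProd X α ξ) with hc
  have hgeo : Summable fun k => ‖ξ‖ ^ 2 * ρ ^ k := (summable_geometric_of_lt_one hρ0 hρ1).mul_left _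
  have sA : Summable (tA R c) := Summable.of_norm_bounded hgeo fun k =>
    (tA_norm isoR c k).trans (norm_coef hρ0 hρ ξ k)
  have sB : Summable (tB R (fun α => star (c α))) := Summable.of_norm_bounded hgeo fun k =>
    (tB_norm isoR _ k).trans (by simpa only [norm_star] using norm_coef hρ0 hρ ξ k)
  have sA' := (summable_nat_add_iff 1).mpr sA
  have sB' := (summable_nat_add_iff 1).mpr sB
  set T : opSys R := (∑' k, tB R (fun α => star (c α)) (k+1)) + ((‖ξ‖ ^ 2 : ℝ) : ℂ) • elR R 1
    + ∑' k, tA R c (k+1) with hT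
  have hone : elR R 1 = elRadj R (revWord 1) := by
    apply Subtype.ext
    simp only [elR, elRadj, wordProd_one, rev_one]
    exact (star_one (F →L[ℂ] F)).symm
  have hval : μ T = inner ℂ ξ (phOp (aCoeff R μ) (bCoeff R μ) X ξ) := by
    set μ' : opSys R →L[ℂ] ℂ := ⟨μ, posCont hμ⟩ with hμ'
    have e1 : μ T = μ' T := rfl
    rw [inner_phOp hs hs', e1, hT, map_add, map_add, map_smul, μ'.map_tsum sA', μ'.map_tsum sB']
    congr 1
    · congr 1
      · refine tsum_congr fun k => ?_
        change μ _ = _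
        rw [tB, map_sum, truncSumAdj, _root_.sum_apply, inner_sum]
        refine Finset.sum_congr rfl fun f _ => ?_
        rw [map_smul, _root_.smul_apply, inner_smul_right, adjoint_inner_right, smul_eq_mul, mul_comm]
        congr 1
        exact inner_conj_symm _ _
      · rw [hone, smul_eq_mul, mul_comm, inner_self_eq_norm_sq_to_K]
        simp [aCoeff, hμ']
    · refine tsum_congr fun k => ?_
      change μ _ = _
      rw [tA, map_sum, truncSum, _root_.sum_apply, inner_sum]
      refine Finset.sum_congr rfl fun f _ => ?_
      rw [map_smul, _root_.smul_apply, inner_smul_right, smul_eq_mul, mul_comm]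
      rfl
  rw [← hval]
  apply hμ
  have hAc : Summable fun k => (tA R c k : F →L[ℂ] F) := sA.map (opSys R).subtypeL (opSys R).subtypeL.continuous
  set H := ∑' k, (tA R c k : F →L[ℂ] F) with hH
  have hz : ∀ d : Word n → ℂ, (tA R d 0 : F →L[ℂ] F) = d 1 • 1 := by
    intro d
    rw [tA_coe]
    simp only [word_zero, rev_one, wordProd_one, Finset.univ_unique, Finset.sum_singleton]
    congr 1
    exact star_one (F →L[ℂ] F)
  have hzB : ∀ d : Word n → ℂ, (tB R d 0 : F →L[ℂ] F) = d 1 • 1 := by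
    intro d
    rw [tB_coe]
    simp [word_zero, rev_one, wordProd_one]
  have hc1 : c 1 = ((‖ξ‖ ^ 2 : ℝ) : ℂ) := by
    simp only [hc, wordProd_one, one_apply_eq_self, inner_self_eq_norm_sq_to_K]
    simp
  have hTc : (T : F →L[ℂ] F) = adjoint H + H - ((‖ξ‖ ^ 2 : ℝ) : ℂ) • (1 : F →L[ℂ] F) := by
    have t1 : ((∑' k, tA R c (k+1) : opSys R) : F →L[ℂ] F) = H - ((‖ξ‖ ^ 2 : ℝ) : ℂ) • 1 := by
      have := (opSys R).subtypeL.map_tsum sA'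
      simp only [Submodule.subtypeL_apply] at this
      rw [this, hH, hAc.tsum_eq_zero_add, hz, hc1, add_sub_cancel_left]
    have t2 : ((∑' k, tB R (fun α => star (c α)) (k+1) : opSys R) : F →L[ℂ] F)
        = adjoint H - ((‖ξ‖ ^ 2 : ℝ) : ℂ) • 1 := by
      have hBc : Summable fun k => (tB R (fun α => star (c α)) k : F →L[ℂ] F) :=
        sB.map (opSys R).subtypeL (opSys R).subtypeL.continuous
      have := (opSys R).subtypeL.map_tsum sB'
      simp only [Submodule.subtypeL_apply] at this
      have hadj : adjoint H = ∑' k, (tB R (fun α => star (c α)) k : F →L[ℂ] F) := by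
        simp only [tB_adj]
        exact (adjoint : (F →L[ℂ] F) ≃ₗᵢ⋆[ℂ] (F →L[ℂ] F)).toContinuousLinearEquiv.map_tsum
      rw [this, hadj, hBc.tsum_eq_zero_add, hzB, hc1]
      simp
    rw [hT, Submodule.coe_add, Submodule.coe_add, Submodule.coe_smul, elR_one, t1, t2]
    abel
  rw [hTc, ContinuousLinearMap.isPositive_iff_complex]
  intro f
  have hfc := full_core e hR hρ0 hρ1.le hρ ξ hAc f
  rw [← hH] at hfc
  have hin : inner ℂ ((adjoint H + H - ((‖ξ‖ ^ 2 : ℝ) : ℂ) • (1 : F →L[ℂ] F)) f) f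
      = ((2 * (inner ℂ f (H f)).re - ‖ξ‖ ^ 2 * ‖f‖ ^ 2 : ℝ) : ℂ) := by
    rw [_root_.sub_apply, _root_.add_apply, _root_.smul_apply, one_apply_eq_self,
      inner_sub_left, inner_add_left, adjoint_inner_left, inner_smul_left, inner_self_eq_norm_sq_to_K,
      ← inner_conj_symm (H f) f, Complex.add_conj, Complex.conj_ofReal]
    push_cast; rfl
  rw [hin]
  exact cpos (Complex.zero_le_real.mpr hfc)

end part1b

/-- `μ ↦ u^μ = P μ` is a one-to-one correspondence between positive
linear functionals on the operator system `R_n* + R_n` and positive free pluriharmonic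
functions with scalar coefficients on the unit ball. -/
theorem stmt_19 (n : ℕ) (hn : 1 ≤ n)
    (F : Type) [NormedAddCommGroup F] [InnerProductSpace ℂ F] [CompleteSpace F]
    (e : HilbertBasis (Word n) ℂ F)
    (R : Fin n → F →L[ℂ] F)
    (hR : ∀ (i : Fin n) (α : Word n), R i (e α) = e (α * FreeMonoid.of i)) :
    -- (1) every positive functional gives a positive free pluriharmonic function
    (∀ μ : ↥(opSys R) →ₗ[ℂ] ℂ, posFun R μ →
      radCond 1 (aCoeff R μ) ∧ radCond 1 (bCoeff R μ) ∧
        posPH 1 (aCoeff R μ) (bCoeff R μ)) ∧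
    -- (2) the correspondence is injective
    (∀ μ ν : ↥(opSys R) →ₗ[ℂ] ℂ, posFun R μ → posFun R ν →
      (∀ α : Word n, aCoeff R μ α = aCoeff R ν α) →
      (∀ α : Word n, 1 ≤ wordLen α → bCoeff R μ α = bCoeff R ν α) →
      μ = ν) ∧
    -- (3) every positive free pluriharmonic function arises this way
    (∀ a b : Word n → ℂ, radCond 1 a → radCond 1 b → posPH 1 a b →
      ∃ μ : ↥(opSys R) →ₗ[ℂ] ℂ, posFun R μ ∧
        (∀ α : Word n, a α = aCoeff R μ α) ∧
        (∀ α : Word n, 1 ≤ wordLen α → b α = bCoeff R μ α)) := by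
  exact ⟨fun μ hμ => part1 e hR hμ, fun μ ν hμ hν ha hb => part2 hμ hν ha hb,
    fun a b ha hb hp => part3 e hR ha hb hp⟩

end
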